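/- arXiv:2506.08858 — 3 statements merged into one kernel-verified Lean document; each statement's English description precedes it below -/
import Mathlib

section
/- Let L be a finite polygonal lattice with λ : CovRel(L) → E a forcing-consistent polygonal edge labelling which is moreover polygon-complete, θ a lattice congruence on L, and q : L → L/θ the quotient map. Then the induced map [C] ↦ [q(C)] from (square-equivalence classes of maximal chains of L, ≼_λ) to (square-equivalence classes of maximal chains of L/θ, ≼_{λ_θ}) is a contraction of preordered sets. -/
/-! Generic order-theoretic definitions: covering relations, intervals, maximal
chains in subposets, polygons, polygon/square moves, square-equivalence,
ascending chains with respect to an edge labelling, increasing polygon moves,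
and the induced preorder on (square-equivalence classes of) maximal chains. -/

section GenericOrder

variable {α : Type*}

/-- `b` covers `a` with respect to the relation `r`. -/
def CovR (r : α → α → Prop) (a b : α) : Prop :=
  r a b ∧ a ≠ b ∧ ∀ z, r a z → r z b → z = a ∨ z = b

/-- The closed interval from `x` to `y` with respect to `r`. -/
def IccR (r : α → α → Prop) (x y : α) : Set α := {z | r x z ∧ r z y}

/-- `C` is a maximal chain of the subposet `S` (with respect to `r`). -/
def MaxChainIn (r : α → α → Prop) (S C : Set α) : Prop :=
  C ⊆ S ∧ IsChain r C ∧ ∀ C' : Set α, C' ⊆ S → IsChain r C' → C ⊆ C' → C = C'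

/-- `(x, y, C₁, C₂)` form a polygon: the interval `[x, y]` has exactly the two
distinct maximal chains `C₁ ≠ C₂`, whose union is the interval and whose
intersection is `{x, y}`. -/
def IsPolygonPair (r : α → α → Prop) (x y : α) (C₁ C₂ : Set α) : Prop :=
  r x y ∧ MaxChainIn r (IccR r x y) C₁ ∧ MaxChainIn r (IccR r x y) C₂ ∧
    C₁ ≠ C₂ ∧ IccR r x y = C₁ ∪ C₂ ∧ C₁ ∩ C₂ = {x, y} ∧
    ∀ C : Set α, MaxChainIn r (IccR r x y) C → C = C₁ ∨ C = C₂

/-- `P` is a polygon with respect to `r`. -/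
def IsPolygon (r : α → α → Prop) (P : Set α) : Prop :=
  ∃ x y C₁ C₂, P = IccR r x y ∧ IsPolygonPair r x y C₁ C₂

/-- `C` and `C'` are related by a polygon move. -/
def PolygonMove (r : α → α → Prop) (C C' : Set α) : Prop :=
  ∃ x y P₁ P₂, IsPolygonPair r x y P₁ P₂ ∧ P₁ ⊆ C ∧ P₂ ⊆ C' ∧ C \ P₁ = C' \ P₂

/-- `C` and `C'` are related by a square move: a polygon move across a
four-element polygon. -/
def SquareMove (r : α → α → Prop) (C C' : Set α) : Prop :=
  ∃ x y P₁ P₂, IsPolygonPair r x y P₁ P₂ ∧ (IccR r x y).ncard = 4 ∧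
    P₁ ⊆ C ∧ P₂ ⊆ C' ∧ C \ P₁ = C' \ P₂

/-- Square-equivalence: the reflexive-transitive closure of square moves. -/
def SqEquiv (r : α → α → Prop) : Set α → Set α → Prop :=
  Relation.ReflTransGen (SquareMove r)

/-- The chain `C` has strictly increasing edge labels (with respect to the
strict order `lt` on labels): for any two covering pairs occurring along `C`,
the earlier one has strictly smaller label. -/
def ChainAscending {E : Type*} (r : α → α → Prop) (lab : α → α → E)
    (lt : E → E → Prop) (C : Set α) : Prop :=
  ∀ a b c d, a ∈ C → b ∈ C → c ∈ C → d ∈ C →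
    CovR r a b → CovR r c d → r b c → lt (lab a b) (lab c d)

/-- `C'` is an increasing polygon move of `C`: they differ by a polygon move
across a non-square polygon, with `C` containing the ascending chain. -/
def IncPolygonMove {E : Type*} (r : α → α → Prop) (lab : α → α → E)
    (lt : E → E → Prop) (C C' : Set α) : Prop :=
  ∃ x y P₁ P₂, IsPolygonPair r x y P₁ P₂ ∧ (IccR r x y).ncard ≠ 4 ∧
    P₁ ⊆ C ∧ P₂ ⊆ C' ∧ C \ P₁ = C' \ P₂ ∧ ChainAscending r lab lt P₁

/-- The preorder `≼` on (square-equivalence classes of) maximal chains: the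
smallest preorder generated by square moves and increasing polygon moves. -/
def MGPre {E : Type*} (r : α → α → Prop) (lab : α → α → E) (lt : E → E → Prop) :
    Set α → Set α → Prop :=
  Relation.ReflTransGen (fun A B => SqEquiv r A B ∨ IncPolygonMove r lab lt A B)

/-- `[C'] covers [C]` in the preorder `≼` on square-equivalence classes of
maximal chains: `[C] ≺ [C']` and every class weakly between them equals `[C]`
or `[C']`. -/
def MGCover {E : Type*} (r : α → α → Prop) (lab : α → α → E) (lt : E → E → Prop)
    (C C' : Set α) : Prop :=
  MGPre r lab lt C C' ∧ ¬ MGPre r lab lt C' C ∧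
    ∀ D : Set α, IsMaxChain r D → MGPre r lab lt C D → MGPre r lab lt D C' →
      SqEquiv r D C ∨ SqEquiv r D C'

/-- The labelling is polygon-complete: increasing polygon moves always give
covering relations of the preorder on square-equivalence classes. -/
def PolygonComplete {E : Type*} (r : α → α → Prop) (lab : α → α → E)
    (lt : E → E → Prop) : Prop :=
  ∀ C C' : Set α, IsMaxChain r C → IsMaxChain r C' → IncPolygonMove r lab lt C C' →
    MGCover r lab lt C C'

end GenericOrder

/-! Lattice-specific definitions: polygonal lattices, lattice congruences,
forcing, forcing-consistent and polygonal edge labellings. -/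

section LatticeDefs

/-- A finite lattice is polygonal if joins of two covers of a common element
and meets of two elements covered by a common element always span polygons. -/
def IsPolygonalLattice (L : Type*) [Lattice L] : Prop :=
  (∀ x y₁ y₂ : L, y₁ ≠ y₂ → x ⋖ y₁ → x ⋖ y₂ →
    IsPolygon (α := L) (· ≤ ·) (IccR (· ≤ ·) x (y₁ ⊔ y₂))) ∧
  (∀ x₁ x₂ y : L, x₁ ≠ x₂ → x₁ ⋖ y → x₂ ⋖ y →
    IsPolygon (α := L) (· ≤ ·) (IccR (· ≤ ·) (x₁ ⊓ x₂) y))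

/-- A lattice congruence: an equivalence relation compatible with joins and
meets. -/
def IsLatticeCongruence {L : Type*} [Lattice L] (θ : L → L → Prop) : Prop :=
  Equivalence θ ∧ ∀ x y z : L, θ x y → θ (x ⊔ z) (y ⊔ z) ∧ θ (x ⊓ z) (y ⊓ z)

/-- The covering relation `a ⋖ b` forces `c ⋖ d`: every lattice congruence
identifying `a` and `b` identifies `c` and `d`. -/
def Forces {L : Type*} [Lattice L] (a b c d : L) : Prop :=
  ∀ θ : L → L → Prop, IsLatticeCongruence θ → θ a b → θ c d

/-- Two covering relations are forcing-equivalent if each forces the other. -/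
def ForcingEquiv {L : Type*} [Lattice L] (a b c d : L) : Prop :=
  Forces a b c d ∧ Forces c d a b

/-- An edge labelling is forcing-consistent if forcing-equivalent covering
relations receive equal labels. -/
def ForcingConsistent {L E : Type*} [Lattice L] (lab : L → L → E) : Prop :=
  ∀ a b c d : L, a ⋖ b → c ⋖ d → ForcingEquiv a b c d → lab a b = lab c d

/-- An edge labelling is polygonal if in every non-square polygon one maximal
chain is ascending and the other descending. -/
def PolygonalLabelling {L E : Type*} [Lattice L] [PartialOrder E]
    (lab : L → L → E) : Prop :=
  ∀ (x y : L) (C₁ C₂ : Set L), IsPolygonPair (· ≤ ·) x y C₁ C₂ →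
    (IccR (α := L) (· ≤ ·) x y).ncard ≠ 4 →
    (ChainAscending (· ≤ ·) lab (· < ·) C₁ ∧
      ChainAscending (· ≤ ·) lab (fun a b => b < a) C₂) ∨
    (ChainAscending (· ≤ ·) lab (· < ·) C₂ ∧
      ChainAscending (· ≤ ·) lab (fun a b => b < a) C₁)

end LatticeDefs

section Gen
variable {α : Type*} [PartialOrder α]

theorem mci_mem {S C : Set α} (h : MaxChainIn (· ≤ ·) S C) {z : α} (hz : z ∈ S)
    (hc : ∀ c ∈ C, c ≤ z ∨ z ≤ c) : z ∈ C := by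
  have := h.2.2 (insert z C) (Set.insert_subset hz h.1)
    (h.2.1.insert (fun b hb _ => (hc b hb).symm)) (Set.subset_insert z C)
  rw [this]; exact Set.mem_insert z C

theorem mci_of {S C : Set α} (h1 : C ⊆ S) (h2 : IsChain (· ≤ ·) C)
    (h3 : ∀ z ∈ S, (∀ c ∈ C, c ≤ z ∨ z ≤ c) → z ∈ C) : MaxChainIn (· ≤ ·) S C := by
  refine ⟨h1, h2, fun C' hS hC hsub => Set.Subset.antisymm hsub fun z hz => ?_⟩
  exact h3 z (hS hz) fun c hc => hC.total (hsub hc) hz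

theorem imc_iff {C : Set α} : IsMaxChain (· ≤ ·) C ↔ MaxChainIn (· ≤ ·) Set.univ C := by
  constructor
  · intro h
    exact ⟨Set.subset_univ _, h.1, fun C' _ hC hs => h.2 hC hs⟩
  · intro h
    exact ⟨h.2.1, fun C' hC hs => h.2.2 C' (Set.subset_univ _) hC hs⟩

theorem mc_mem {C : Set α} (h : IsMaxChain (· ≤ ·) C) {z : α}
    (hc : ∀ c ∈ C, c ≤ z ∨ z ≤ c) : z ∈ C := mci_mem (imc_iff.1 h) trivial hc

theorem mci_ext [Finite α] {S P : Set α} (hP : P ⊆ S) (hc : IsChain (· ≤ ·) P) :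
    ∃ C, MaxChainIn (· ≤ ·) S C ∧ P ⊆ C := by
  obtain ⟨C, hC, hm⟩ := Finite.exists_le_maximal (p := fun C : Set α => C ⊆ S ∧ IsChain (· ≤ ·) C)
    (a := P) ⟨hP, hc⟩
  exact ⟨C, ⟨hm.1.1, hm.1.2, fun C' h1 h2 h3 => Set.Subset.antisymm h3 (hm.2 ⟨h1, h2⟩ h3)⟩, hC⟩

theorem covR_iff {a b : α} : CovR (· ≤ ·) a b ↔ a ⋖ b := by
  constructor
  · rintro ⟨h1, h2, h3⟩
    refine ⟨lt_of_le_of_ne h1 h2, fun z hz hz' => ?_⟩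
    rcases h3 z hz.le hz'.le with h | h
    · exact hz.ne' h
    · exact hz'.ne h
  · intro h
    refine ⟨h.le, h.lt.ne, fun z h1 h2 => ?_⟩
    exact h.eq_or_eq h1 h2

/-- next element in a chain -/
theorem chain_next [Finite α] {P : Set α} (hP : IsChain (· ≤ ·) P) {a y : α}
    (hy : y ∈ P) (hay : a < y) : ∃ b ∈ P, a < b ∧ ∀ c ∈ P, a < c → b ≤ c := by
  obtain ⟨b, hb, hm⟩ := Finite.exists_le_minimal (p := fun c : α => c ∈ P ∧ a < c)
    (a := y) ⟨hy, hay⟩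
  refine ⟨b, hm.1.1, hm.1.2, fun c hc hac => ?_⟩
  rcases hP.total hm.1.1 hc with h | h
  · exact h
  · exact hm.2 ⟨hc, hac⟩ h

theorem chain_prev [Finite α] {P : Set α} (hP : IsChain (· ≤ ·) P) {a y : α}
    (hy : y ∈ P) (hay : y < a) : ∃ b ∈ P, b < a ∧ ∀ c ∈ P, c < a → c ≤ b := by
  obtain ⟨b, hb, hm⟩ := Finite.exists_le_maximal (p := fun c : α => c ∈ P ∧ c < a)
    (a := y) ⟨hy, hay⟩
  refine ⟨b, hm.1.1, hm.1.2, fun c hc hac => ?_⟩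
  rcases hP.total hm.1.1 hc with h | h
  · exact hm.2 ⟨hc, hac⟩ h
  · exact h

theorem chain_last [Finite α] {P : Set α} (hP : IsChain (· ≤ ·) P) (p : α → Prop) {y : α}
    (hy : y ∈ P) (hay : p y) : ∃ b ∈ P, p b ∧ ∀ c ∈ P, p c → c ≤ b := by
  obtain ⟨b, hb, hm⟩ := Finite.exists_le_maximal (p := fun c : α => c ∈ P ∧ p c)
    (a := y) ⟨hy, hay⟩
  refine ⟨b, hm.1.1, hm.1.2, fun c hc hac => ?_⟩
  rcases hP.total hm.1.1 hc with h | h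
  · exact hm.2 ⟨hc, hac⟩ h
  · exact h

/-- sets convex -/
theorem mci_cov {S P : Set α} (hS : ∀ a ∈ S, ∀ b ∈ S, ∀ z, a ≤ z → z ≤ b → z ∈ S)
    (h : MaxChainIn (· ≤ ·) S P) {a b : α} (ha : a ∈ P) (hb : b ∈ P) (hab : a < b)
    (hn : ∀ c ∈ P, c ≤ a ∨ b ≤ c) : a ⋖ b := by
  refine ⟨hab, fun z h1 h2 => ?_⟩
  have : z ∈ P := mci_mem h (hS a (h.1 ha) b (h.1 hb) z h1.le h2.le) fun c hc => by
    rcases hn c hc with h | h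
    · exact Or.inl (h.trans h1.le)
    · exact Or.inr (h2.le.trans h)
  rcases hn z this with h | h
  · exact absurd h1 h.not_gt
  · exact absurd h2 h.not_gt

theorem mci_next [Finite α] {S P : Set α}
    (hS : ∀ a ∈ S, ∀ b ∈ S, ∀ z, a ≤ z → z ≤ b → z ∈ S)
    (h : MaxChainIn (· ≤ ·) S P) {a y : α} (ha : a ∈ P) (hy : y ∈ P) (hay : a < y) :
    ∃ b ∈ P, a ⋖ b := by
  obtain ⟨b, hb, hab, hn⟩ := chain_next h.2.1 hy hay
  refine ⟨b, hb, mci_cov hS h ha hb hab fun c hc => ?_⟩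
  rcases h.2.1.total hc ha with h' | h'
  · exact Or.inl h'
  · rcases h'.eq_or_lt with h' | h'
    · exact Or.inl h'.ge
    · exact Or.inr (hn c hc h')

theorem mci_prev [Finite α] {S P : Set α}
    (hS : ∀ a ∈ S, ∀ b ∈ S, ∀ z, a ≤ z → z ≤ b → z ∈ S)
    (h : MaxChainIn (· ≤ ·) S P) {a y : α} (ha : a ∈ P) (hy : y ∈ P) (hay : y < a) :
    ∃ b ∈ P, b ⋖ a := by
  obtain ⟨b, hb, hab, hn⟩ := chain_prev h.2.1 hy hay
  refine ⟨b, hb, mci_cov hS h hb ha hab fun c hc => ?_⟩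
  rcases h.2.1.total hc ha with h' | h'
  · rcases h'.eq_or_lt with h' | h'
    · exact Or.inr h'.ge
    · exact Or.inl (hn c hc h')
  · exact Or.inr h'

theorem icc_conv (x y : α) : ∀ a ∈ IccR (· ≤ ·) x y, ∀ b ∈ IccR (· ≤ ·) x y, ∀ z,
    a ≤ z → z ≤ b → z ∈ IccR (α := α) (· ≤ ·) x y :=
  fun _ ha _ hb _ h1 h2 => ⟨ha.1.trans h1, h2.trans hb.2⟩

/- polygons -/
variable {x y : α} {P₁ P₂ : Set α}

theorem pp_symm (h : IsPolygonPair (· ≤ ·) x y P₁ P₂) : IsPolygonPair (· ≤ ·) x y P₂ P₁ := by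
  obtain ⟨h1, h2, h3, h4, h5, h6, h7⟩ := h
  exact ⟨h1, h3, h2, h4.symm, by rw [h5, Set.union_comm], by rw [← h6, Set.inter_comm],
    fun C hC => (h7 C hC).symm⟩

theorem pp_x (h : IsPolygonPair (· ≤ ·) x y P₁ P₂) : x ∈ P₁ := by
  have : x ∈ P₁ ∩ P₂ := by rw [h.2.2.2.2.2.1]; simp
  exact this.1

theorem pp_y (h : IsPolygonPair (· ≤ ·) x y P₁ P₂) : y ∈ P₁ := by
  have : y ∈ P₁ ∩ P₂ := by rw [h.2.2.2.2.2.1]; simp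
  exact this.1

theorem pp_inter (h : IsPolygonPair (· ≤ ·) x y P₁ P₂) {z : α} (h1 : z ∈ P₁) (h2 : z ∈ P₂) :
    z = x ∨ z = y := by
  have : z ∈ P₁ ∩ P₂ := ⟨h1, h2⟩
  rw [h.2.2.2.2.2.1] at this
  simpa using this

theorem pp_le (h : IsPolygonPair (· ≤ ·) x y P₁ P₂) {z : α} (h1 : z ∈ P₁) : x ≤ z ∧ z ≤ y :=
  h.2.1.1 h1

theorem pp_int (h : IsPolygonPair (· ≤ ·) x y P₁ P₂) : ∃ z ∈ P₁, z ≠ x ∧ z ≠ y := by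
  by_contra hcon
  push Not at hcon
  apply h.2.2.2.1
  refine h.2.1.2.2 P₂ h.2.2.1.1 h.2.2.1.2.1 fun z hz => ?_
  by_cases hzx : z = x
  · rw [hzx]; exact pp_x (pp_symm h)
  · rw [hcon z hz hzx]; exact pp_y (pp_symm h)

theorem pp_cross [Finite α] (h : IsPolygonPair (· ≤ ·) x y P₁ P₂) {z w : α} (h1 : z ∈ P₁)
    (h2 : w ∈ P₂) (hzw : z ≤ w) : z = x ∨ w = y := by
  obtain ⟨C, hC, hs⟩ := mci_ext (S := IccR (· ≤ ·) x y) (P := {z, w})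
    (by
      rintro u (rfl | rfl)
      · exact h.2.1.1 h1
      · exact h.2.2.1.1 h2)
    (IsChain.pair hzw)
  have hz : z ∈ C := hs (by simp)
  have hw : w ∈ C := hs (by simp)
  rcases h.2.2.2.2.2.2 C hC with rfl | rfl
  · rcases pp_inter h hw h2 with h' | h'
    · left; exact le_antisymm (h' ▸ hzw) (pp_le h h1).1
    · exact Or.inr h'
  · rcases pp_inter h h1 hz with h' | h'
    · exact Or.inl h'
    · right; exact le_antisymm (pp_le (pp_symm h) h2).2 (h' ▸ hzw)

theorem pp_card [Finite α] (h : IsPolygonPair (· ≤ ·) x y P₁ P₂) :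
    4 ≤ (IccR (· ≤ ·) x y).ncard := by
  obtain ⟨z, hz, hzx, hzy⟩ := pp_int h
  obtain ⟨w, hw, hwx, hwy⟩ := pp_int (pp_symm h)
  have hzw : z ≠ w := by
    rintro rfl
    rcases pp_inter h hz hw with h | h
    · exact hzx h
    · exact hzy h
  have hxy : x ≠ y := by
    rintro rfl
    exact hzx (le_antisymm (pp_le h hz).2 (pp_le h hz).1)
  have : ({x, y, z, w} : Set α) ⊆ IccR (· ≤ ·) x y := by
    rintro u (rfl | rfl | rfl | rfl)
    · exact h.2.1.1 (pp_x h)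
    · exact h.2.1.1 (pp_y h)
    · exact h.2.1.1 hz
    · exact h.2.2.1.1 hw
  have h2 := Set.ncard_le_ncard this (Set.toFinite _)
  have h3 : ({x, y, z, w} : Set α).ncard = 4 := by
    rw [Set.ncard_insert_of_notMem, Set.ncard_insert_of_notMem, Set.ncard_pair hzw]
    · simp [hzy.symm, hwy.symm]
    · simp [hxy, hzx.symm, hwx.symm]
  omega

theorem pp_edges [Finite α] (h : IsPolygonPair (· ≤ ·) x y P₁ P₂) :
    ∃ a b c, a ∈ P₁ ∧ b ∈ P₁ ∧ c ∈ P₁ ∧ a ⋖ b ∧ b ⋖ c := by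
  obtain ⟨z, hz, hzx, hzy⟩ := pp_int h
  obtain ⟨a, ha, haz⟩ := mci_prev (icc_conv x y) h.2.1 hz (pp_x h)
    (lt_of_le_of_ne (pp_le h hz).1 hzx.symm)
  obtain ⟨c, hc, hzc⟩ := mci_next (icc_conv x y) h.2.1 hz (pp_y h)
    (lt_of_le_of_ne (pp_le h hz).2 hzy)
  exact ⟨a, z, c, ha, hz, hc, haz, hzc⟩

theorem pp_atom [Finite α] (h : IsPolygonPair (· ≤ ·) x y P₁ P₂) :
    ∃ a ∈ P₁, x ⋖ a ∧ a ≠ y := by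
  obtain ⟨z, hz, hzx, hzy⟩ := pp_int h
  have hxz : x < z := lt_of_le_of_ne (pp_le h hz).1 hzx.symm
  have hzy : z < y := lt_of_le_of_ne (pp_le h hz).2 hzy
  obtain ⟨a, ha, hxa⟩ := mci_next (icc_conv x y) h.2.1 (pp_x h) hz hxz
  refine ⟨a, ha, hxa, ?_⟩
  rintro rfl
  exact hxa.2 hxz hzy

/-- Polygon move with data. -/
def Mv (x y : α) (P₁ P₂ C C' : Set α) : Prop :=
  IsPolygonPair (· ≤ ·) x y P₁ P₂ ∧ P₁ ⊆ C ∧ P₂ ⊆ C' ∧ C \ P₁ = C' \ P₂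

variable {C C' : Set α}

theorem Mv.symm (h : Mv x y P₁ P₂ C C') : Mv x y P₂ P₁ C' C :=
  ⟨pp_symm h.1, h.2.2.1, h.2.1, h.2.2.2.symm⟩

theorem Mv.out (h : Mv x y P₁ P₂ C C') (hC : IsChain (· ≤ ·) C) {c : α} (hc : c ∈ C)
    (hcP : c ∉ P₁) : c ≤ x ∨ y ≤ c := by
  rcases hC.total hc (h.2.1 (pp_x h.1)) with h1 | h1
  · exact Or.inl h1
  rcases hC.total hc (h.2.1 (pp_y h.1)) with h2 | h2
  · exact absurd (mci_mem h.1.2.1 ⟨h1, h2⟩ fun d hd => hC.total (h.2.1 hd) hc) hcP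
  · exact Or.inr h2

theorem Mv.max (h : Mv x y P₁ P₂ C C') (hC : IsMaxChain (· ≤ ·) C) :
    IsMaxChain (· ≤ ·) C' := by
  have hmem : ∀ c ∈ C', c ∈ P₂ ∨ (c ∈ C ∧ c ∉ P₁) := fun c hc => by
    by_cases h2 : c ∈ P₂
    · exact Or.inl h2
    · right
      have : c ∈ C' \ P₂ := ⟨hc, h2⟩
      rw [← h.2.2.2] at this
      exact this
  have hpp := pp_symm h.1
  have hout : ∀ c ∈ C, c ∉ P₁ → ∀ d ∈ P₂, c ≤ d ∨ d ≤ c := fun c hc hcP d hd => by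
    rcases h.out hC.1 hc hcP with h1 | h1
    · exact Or.inl (h1.trans (pp_le hpp hd).1)
    · exact Or.inr ((pp_le hpp hd).2.trans h1)
  rw [imc_iff]
  refine mci_of (Set.subset_univ _) ?_ ?_
  · intro a ha b hb _
    rcases hmem a ha with ha | ha <;> rcases hmem b hb with hb | hb
    · exact hpp.2.1.2.1.total ha hb
    · exact (hout b hb.1 hb.2 a ha).symm
    · exact hout a ha.1 ha.2 b hb
    · exact hC.1.total ha.1 hb.1
  · intro z _ hz
    have key : ∀ c ∈ C, c ∉ P₁ → c ≤ z ∨ z ≤ c := fun c hc hcP => hz c (by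
      have : c ∈ C \ P₁ := ⟨hc, hcP⟩
      rw [h.2.2.2] at this
      exact this.1)
    have fin : z ∈ C → (z ∈ P₁ → z ∈ P₂) → z ∈ C' := fun h1 h2 => by
      by_cases h3 : z ∈ P₁
      · exact h.2.2.1 (h2 h3)
      · have : z ∈ C \ P₁ := ⟨h1, h3⟩
        rw [h.2.2.2] at this
        exact this.1
    rcases hz x (h.2.2.1 (pp_x hpp)) with h1 | h1
    · rcases hz y (h.2.2.1 (pp_y hpp)) with h2 | h2
      · refine fin (mc_mem hC fun c hc => ?_) fun h3 => ?_
        · by_cases hcP : c ∈ P₁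
          · exact Or.inl ((pp_le h.1 hcP).2.trans h2)
          · exact key c hc hcP
        · rw [le_antisymm (pp_le h.1 h3).2 h2]; exact pp_y hpp
      · exact h.2.2.1 (mci_mem hpp.2.1 ⟨h1, h2⟩ fun c hc => hz c (h.2.2.1 hc))
    · refine fin (mc_mem hC fun c hc => ?_) fun h3 => ?_
      · by_cases hcP : c ∈ P₁
        · exact Or.inr (h1.trans (pp_le h.1 hcP).1)
        · exact key c hc hcP
      · rw [le_antisymm h1 (pp_le h.1 h3).1]; exact pp_x hpp

theorem Mv.exists (h : IsPolygonPair (· ≤ ·) x y P₁ P₂) (hC : IsChain (· ≤ ·) C) (hP : P₁ ⊆ C) :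
    Mv x y P₁ P₂ C ((C \ P₁) ∪ P₂) := by
  refine ⟨h, hP, Set.subset_union_right, ?_⟩
  ext c
  simp only [Set.mem_sdiff, Set.mem_union]
  constructor
  · rintro ⟨h1, h2⟩
    refine ⟨Or.inl ⟨h1, h2⟩, fun h3 => h2 ?_⟩
    have h4 := pp_le (pp_symm h) h3
    exact mci_mem h.2.1 h4 fun d hd => hC.total (hP hd) h1
  · tauto

variable {E : Type*} {lab : α → α → E} {lt : E → E → Prop}

theorem sqm_iff : SquareMove (· ≤ ·) C C' ↔
    ∃ x y P₁ P₂, Mv x y P₁ P₂ C C' ∧ (IccR (α := α) (· ≤ ·) x y).ncard = 4 := by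
  constructor
  · rintro ⟨x, y, P₁, P₂, h1, h2, h3, h4, h5⟩
    exact ⟨x, y, P₁, P₂, ⟨h1, h3, h4, h5⟩, h2⟩
  · rintro ⟨x, y, P₁, P₂, ⟨h1, h3, h4, h5⟩, h2⟩
    exact ⟨x, y, P₁, P₂, h1, h2, h3, h4, h5⟩

theorem inc_iff : IncPolygonMove (· ≤ ·) lab lt C C' ↔
    ∃ x y P₁ P₂, Mv x y P₁ P₂ C C' ∧ (IccR (α := α) (· ≤ ·) x y).ncard ≠ 4 ∧
      ChainAscending (· ≤ ·) lab lt P₁ := by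
  constructor
  · rintro ⟨x, y, P₁, P₂, h1, h2, h3, h4, h5, h6⟩
    exact ⟨x, y, P₁, P₂, ⟨h1, h3, h4, h5⟩, h2, h6⟩
  · rintro ⟨x, y, P₁, P₂, ⟨h1, h3, h4, h5⟩, h2, h6⟩
    exact ⟨x, y, P₁, P₂, h1, h2, h3, h4, h5, h6⟩

theorem sqm_symm (h : SquareMove (α := α) (· ≤ ·) C C') : SquareMove (α := α) (· ≤ ·) C' C := by
  rw [sqm_iff] at *
  obtain ⟨x, y, P₁, P₂, h1, h2⟩ := h
  exact ⟨x, y, P₂, P₁, h1.symm, h2⟩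

theorem sq_symm (h : SqEquiv (α := α) (· ≤ ·) C C') : SqEquiv (α := α) (· ≤ ·) C' C := by
  induction h with
  | refl => exact .refl
  | tail _ h2 ih => exact .head (sqm_symm h2) ih

theorem sq_max (h : SqEquiv (α := α) (· ≤ ·) C C') (hC : IsMaxChain (· ≤ ·) C) :
    IsMaxChain (· ≤ ·) C' := by
  induction h with
  | refl => exact hC
  | tail _ h2 ih =>
    rw [sqm_iff] at h2
    obtain ⟨x, y, P₁, P₂, h1, h2⟩ := h2
    exact h1.max ih

theorem sq_pre (h : SqEquiv (α := α) (· ≤ ·) C C') : MGPre (· ≤ ·) lab lt C C' :=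
  .single (Or.inl h)

theorem inc_max (h : IncPolygonMove (α := α) (· ≤ ·) lab lt C C') (hC : IsMaxChain (· ≤ ·) C) :
    IsMaxChain (· ≤ ·) C' := by
  obtain ⟨x, y, P₁, P₂, h1, h2⟩ := inc_iff.1 h
  exact h1.max hC

theorem step_max (h : SqEquiv (α := α) (· ≤ ·) C C' ∨ IncPolygonMove (α := α) (· ≤ ·) lab lt C C')
    (hC : IsMaxChain (· ≤ ·) C) : IsMaxChain (· ≤ ·) C' :=
  h.elim (fun h => sq_max h hC) (fun h => inc_max h hC)

theorem pre_max (h : MGPre (α := α) (· ≤ ·) lab lt C C')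
    (hC : IsMaxChain (· ≤ ·) C) : IsMaxChain (· ≤ ·) C' := by
  induction h with
  | refl => exact hC
  | tail _ h2 ih => exact step_max h2 ih

/-- MGPre by elementary moves -/
theorem pre_iff : MGPre (α := α) (· ≤ ·) lab lt C C' ↔
    Relation.ReflTransGen (fun A B => SquareMove (· ≤ ·) A B ∨
      IncPolygonMove (· ≤ ·) lab lt A B) C C' := by
  constructor
  · intro h
    induction h with
    | refl => exact .refl
    | tail _ h2 ih =>
      refine ih.trans ?_
      rcases h2 with h2 | h2
      · exact Relation.ReflTransGen.mono (fun _ _ h => Or.inl h) _ _ h2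
      · exact .single (Or.inr h2)
  · intro h
    exact Relation.ReflTransGen.mono (fun _ _ h => h.imp (fun h => .single h) id) _ _ h

end Gen
section Quot
variable {L M : Type*} [Lattice L] [Lattice M]

structure QH (q : L → M) : Prop where
  surj : Function.Surjective q
  sup : ∀ x y : L, q (x ⊔ y) = q x ⊔ q y
  inf : ∀ x y : L, q (x ⊓ y) = q x ⊓ q y

variable {q : L → M}

theorem QH.mono (hq : QH q) {a b : L} (h : a ≤ b) : q a ≤ q b := by
  have := hq.sup a b
  rw [sup_eq_right.2 h] at this
  rw [this]; exact le_sup_left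

theorem QH.chain (hq : QH q) {C : Set L} (h : IsChain (· ≤ ·) C) : IsChain (· ≤ ·) (q '' C) := by
  rintro _ ⟨a, ha, rfl⟩ _ ⟨b, hb, rfl⟩ _
  exact (h.total ha hb).imp hq.mono hq.mono

/-- key image lemma -/
theorem QH.img [Finite L] (hq : QH q) {S P : Set L} {x y : L} (hx : x ∈ S) (hy : y ∈ S)
    (hxS : ∀ z ∈ S, x ≤ z) (hyS : ∀ z ∈ S, z ≤ y)
    (hsup : ∀ a ∈ S, ∀ b ∈ S, a ⊔ b ∈ S) (hinf : ∀ a ∈ S, ∀ b ∈ S, a ⊓ b ∈ S)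
    (hP : MaxChainIn (· ≤ ·) S P) {m : M} (hm : m ∈ q '' S)
    (hc : ∀ c ∈ P, q c ≤ m ∨ m ≤ q c) : m ∈ q '' P := by
  obtain ⟨c, hcS, rfl⟩ := hm
  have hxP : x ∈ P := mci_mem hP hx fun d hd => Or.inr (hxS d (hP.1 hd))
  have hyP : y ∈ P := mci_mem hP hy fun d hd => Or.inl (hyS d (hP.1 hd))
  obtain ⟨a, ha, hqa, hl⟩ := chain_last hP.2.1 (fun z => q z ≤ q c) hxP (hq.mono (hxS c hcS))
  by_cases hay : a = y
  · refine ⟨a, ha, le_antisymm hqa ?_⟩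
    rw [hay]; exact hq.mono (hyS c hcS)
  · obtain ⟨b, hb, hab, hn⟩ := chain_next hP.2.1 hyP (lt_of_le_of_ne (hyS a (hP.1 ha)) hay)
    have hqb : q c ≤ q b := by
      rcases hc b hb with h | h
      · exact absurd (hl b hb h) hab.not_ge
      · exact h
    refine ⟨(c ⊔ a) ⊓ b, mci_mem hP (hinf _ (hsup _ hcS _ (hP.1 ha)) _ (hP.1 hb)) ?_, ?_⟩
    · intro d hd
      rcases hP.2.1.total hd ha with h | h
      · exact Or.inl (le_inf (h.trans le_sup_right) (h.trans hab.le))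
      · rcases h.eq_or_lt with h | h
        · left; rw [← h]; exact le_inf le_sup_right hab.le
        · exact Or.inr (inf_le_right.trans (hn d hd h))
    · rw [hq.inf, hq.sup, sup_eq_left.2 hqa, inf_eq_left.2 hqb]

theorem QH.icc (hq : QH q) {x y : L} (hxy : x ≤ y) :
    q '' (IccR (· ≤ ·) x y) = IccR (· ≤ ·) (q x) (q y) := by
  ext m
  constructor
  · rintro ⟨c, hc, rfl⟩
    exact ⟨hq.mono hc.1, hq.mono hc.2⟩
  · rintro ⟨h1, h2⟩
    obtain ⟨c, rfl⟩ := hq.surj m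
    refine ⟨(c ⊔ x) ⊓ y, ⟨le_inf le_sup_right hxy, inf_le_right⟩, ?_⟩
    rw [hq.inf, hq.sup, sup_eq_left.2 h1, inf_eq_left.2 h2]

theorem QH.img_icc [Finite L] (hq : QH q) {x y : L} (hxy : x ≤ y) {P : Set L}
    (hP : MaxChainIn (· ≤ ·) (IccR (· ≤ ·) x y) P) :
    MaxChainIn (· ≤ ·) (IccR (· ≤ ·) (q x) (q y)) (q '' P) := by
  refine mci_of ?_ (hq.chain hP.2.1) ?_
  · rw [← hq.icc hxy]; exact Set.image_mono hP.1
  · intro m hm hc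
    rw [← hq.icc hxy] at hm
    exact hq.img (S := IccR (· ≤ ·) x y) ⟨le_rfl, hxy⟩ ⟨hxy, le_rfl⟩ (fun z hz => hz.1)
      (fun z hz => hz.2)
      (fun a ha b hb => ⟨ha.1.trans le_sup_left, sup_le ha.2 hb.2⟩)
      (fun a ha b hb => ⟨le_inf ha.1 hb.1, inf_le_left.trans ha.2⟩) hP hm
      (fun c hc' => hc _ ⟨c, hc', rfl⟩)

theorem bot_top (L : Type*) [Lattice L] [Finite L] [Nonempty L] :
    ∃ b t : L, ∀ z, b ≤ z ∧ z ≤ t := by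
  obtain ⟨b, hb⟩ := (Set.finite_univ (α := L)).bddBelow
  obtain ⟨t, ht⟩ := (Set.finite_univ (α := L)).bddAbove
  exact ⟨b, t, fun z => ⟨hb trivial, ht trivial⟩⟩

theorem QH.img_max [Finite L] [Nonempty L] (hq : QH q) {C : Set L} (hC : IsMaxChain (· ≤ ·) C) :
    IsMaxChain (· ≤ ·) (q '' C) := by
  obtain ⟨b, t, hbt⟩ := bot_top L
  rw [imc_iff] at *
  refine mci_of (Set.subset_univ _) (hq.chain hC.2.1) fun m _ hm => ?_
  refine hq.img (S := Set.univ) (x := b) (y := t) trivial trivial (fun z _ => (hbt z).1)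
    (fun z _ => (hbt z).2) (fun _ _ _ _ => trivial) (fun _ _ _ _ => trivial) hC
    ?_ (fun c hc => hm _ ⟨c, hc, rfl⟩)
  rw [Set.image_univ]; exact hq.surj m

/-- lifting chains -/
theorem QH.lift [Finite L] [Nonempty L] (hq : QH q) {D : Set M} (hD : IsMaxChain (· ≤ ·) D)
    {P : Set L} (hP : IsChain (· ≤ ·) P) (hPD : ∀ z ∈ P, q z ∈ D) :
    ∃ C : Set L, IsMaxChain (· ≤ ·) C ∧ q '' C = D ∧ P ⊆ C := by
  obtain ⟨b, t, hbt⟩ := bot_top L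
  obtain ⟨C, hC, hPC⟩ := mci_ext (S := q ⁻¹' D) hPD hP
  have hb : b ∈ q ⁻¹' D := mc_mem hD fun c hc => by
    obtain ⟨c, rfl⟩ := hq.surj c
    exact Or.inr (hq.mono (hbt c).1)
  have ht : t ∈ q ⁻¹' D := mc_mem hD fun c hc => by
    obtain ⟨c, rfl⟩ := hq.surj c
    exact Or.inl (hq.mono (hbt c).2)
  have hsub : D ⊆ q '' C := by
    intro d hd
    refine hq.img (S := q ⁻¹' D) hb ht (fun z _ => (hbt z).1)
      (fun z _ => (hbt z).2) ?_ ?_ hC ?_ (fun c hc => hD.1.total (hC.1 hc) hd)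
    · intro a ha b hb
      show q (a ⊔ b) ∈ D
      rw [hq.sup]
      rcases hD.1.total ha hb with h | h
      · rw [sup_eq_right.2 h]; exact hb
      · rw [sup_eq_left.2 h]; exact ha
    · intro a ha b hb
      show q (a ⊓ b) ∈ D
      rw [hq.inf]
      rcases hD.1.total ha hb with h | h
      · rw [inf_eq_left.2 h]; exact ha
      · rw [inf_eq_right.2 h]; exact hb
    · obtain ⟨c, rfl⟩ := hq.surj d
      exact ⟨c, hd, rfl⟩
  have heq : q '' C = D := Set.Subset.antisymm (by rintro _ ⟨c, hc, rfl⟩; exact hC.1 hc) hsub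
  refine ⟨C, ?_, heq, hPC⟩
  rw [imc_iff]
  refine mci_of (Set.subset_univ _) hC.2.1 fun z _ hz => mci_mem hC ?_ hz
  refine mc_mem hD fun d hd => ?_
  obtain ⟨c, hc, rfl⟩ := hsub hd
  exact (hz c hc).imp hq.mono hq.mono

variable {x y : L} {P₁ P₂ : Set L}

theorem pp_sup [Finite L] (h : IsPolygonPair (· ≤ ·) x y P₁ P₂) {z w : L} (hz : z ∈ P₁)
    (hw : w ∈ P₂) (hzx : z ≠ x) (hwx : w ≠ x) : z ⊔ w = y := by
  have hmem : z ⊔ w ∈ IccR (· ≤ ·) x y :=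
    ⟨(pp_le h hz).1.trans le_sup_left, sup_le (pp_le h hz).2 (pp_le (pp_symm h) hw).2⟩
  rw [h.2.2.2.2.1] at hmem
  rcases hmem with h' | h'
  · exact (pp_cross (pp_symm h) hw h' le_sup_right).resolve_left hwx
  · exact (pp_cross h hz h' le_sup_left).resolve_left hzx

theorem pp_inf [Finite L] (h : IsPolygonPair (· ≤ ·) x y P₁ P₂) {z w : L} (hz : z ∈ P₁)
    (hw : w ∈ P₂) (hzx : z ≠ y) (hwx : w ≠ y) : z ⊓ w = x := by
  have hmem : z ⊓ w ∈ IccR (· ≤ ·) x y :=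
    ⟨le_inf (pp_le h hz).1 (pp_le (pp_symm h) hw).1, inf_le_left.trans (pp_le h hz).2⟩
  rw [h.2.2.2.2.1] at hmem
  rcases hmem with h' | h'
  · exact (pp_cross h h' hw inf_le_right).resolve_right hwx
  · exact (pp_cross (pp_symm h) h' hz inf_le_left).resolve_right hzx

/-- collapse case -/
theorem QH.collapse [Finite L] (hq : QH q) (h : IsPolygonPair (· ≤ ·) x y P₁ P₂) {z : L}
    (hz : z ∈ P₁) (hzx : z ≠ x) (hzy : z ≠ y) (he : q z = q x ∨ q z = q y) :
    q '' P₁ = {q x, q y} ∧ q '' P₂ = {q x, q y} := by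
  have key : (∀ w ∈ P₁, q w = q x ∨ q w = q y) ∧ (∀ w ∈ P₂, q w = q x ∨ q w = q y) := by
    obtain ⟨w₀, hw₀, hwx, hwy⟩ := pp_int (pp_symm h)
    rcases he with he | he
    · have h2 : ∀ w ∈ P₂, w ≠ x → q w = q y := fun w hw hwx => by
        have := hq.sup z w
        rw [pp_sup h hz hw hzx hwx, he, ← hq.sup, sup_eq_right.2 (pp_le (pp_symm h) hw).1] at this
        exact this.symm
      refine ⟨fun w hw => ?_, fun w hw => ?_⟩
      · by_cases hy : w = y
        · right; rw [hy]
        left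
        have := hq.inf w w₀
        rw [pp_inf h hw hw₀ hy hwy, h2 w₀ hw₀ hwx, ← hq.inf, inf_eq_left.2 (pp_le h hw).2] at this
        exact this.symm
      · by_cases hx : w = x
        · left; rw [hx]
        · exact Or.inr (h2 w hw hx)
    · have h2 : ∀ w ∈ P₂, w ≠ y → q w = q x := fun w hw hwx => by
        have := hq.inf z w
        rw [pp_inf h hz hw hzy hwx, he, ← hq.inf, inf_eq_right.2 (pp_le (pp_symm h) hw).2] at this
        exact this.symm
      refine ⟨fun w hw => ?_, fun w hw => ?_⟩
      · by_cases hy : w = x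
        · left; rw [hy]
        right
        have := hq.sup w w₀
        rw [pp_sup h hw hw₀ hy hwx, h2 w₀ hw₀ hwy, ← hq.sup, sup_eq_left.2 (pp_le h hw).1] at this
        exact this.symm
      · by_cases hx : w = y
        · right; rw [hx]
        · exact Or.inl (h2 w hw hx)
  have aux : ∀ P : Set L, x ∈ P → y ∈ P → (∀ w ∈ P, q w = q x ∨ q w = q y) →
      q '' P = {q x, q y} := by
    intro P hx hy hP
    ext m
    constructor
    · rintro ⟨w, hw, rfl⟩
      simpa using hP w hw
    · rintro (rfl | rfl)
      · exact ⟨x, hx, rfl⟩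
      · exact ⟨y, hy, rfl⟩
  exact ⟨aux P₁ (pp_x h) (pp_y h) key.1, aux P₂ (pp_x (pp_symm h)) (pp_y (pp_symm h)) key.2⟩

theorem QH.noncollapse [Finite L] (hq : QH q) (h : IsPolygonPair (· ≤ ·) x y P₁ P₂)
    (h1 : ∀ z ∈ P₁, z ≠ x → z ≠ y → q z ≠ q x ∧ q z ≠ q y)
    (h2 : ∀ z ∈ P₂, z ≠ x → z ≠ y → q z ≠ q x ∧ q z ≠ q y) :
    IsPolygonPair (· ≤ ·) (q x) (q y) (q '' P₁) (q '' P₂) := by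
  have hs := pp_symm h
  have hle : ∀ z ∈ P₁, ∀ w ∈ P₂, z ≠ x → z ≠ y → w ≠ x → w ≠ y → ¬ (q z ≤ q w ∨ q w ≤ q z) := by
    intro z hz w hw hzx hzy hwx hwy hc
    have hi := hq.inf z w
    rw [pp_inf h hz hw hzy hwy] at hi
    rcases hc with hc | hc
    · rw [inf_eq_left.2 hc] at hi
      exact (h1 z hz hzx hzy).1 hi.symm
    · rw [inf_eq_right.2 hc] at hi
      exact (h2 w hw hwx hwy).1 hi.symm
  have hM1 := hq.img_icc h.1 h.2.1
  have hM2 := hq.img_icc h.1 hs.2.1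
  have hint : q '' P₁ ∩ q '' P₂ = {q x, q y} := by
    ext m
    constructor
    · rintro ⟨⟨z, hz, rfl⟩, ⟨w, hw, hzw⟩⟩
      by_contra hcon
      simp only [Set.mem_insert_iff, Set.mem_singleton_iff, not_or] at hcon
      refine hle z hz w hw ?_ ?_ ?_ ?_ (Or.inl hzw.ge)
      · rintro rfl; exact hcon.1 rfl
      · rintro rfl; exact hcon.2 rfl
      · rintro rfl; exact hcon.1 hzw.symm
      · rintro rfl; exact hcon.2 hzw.symm
    · rintro (rfl | rfl)
      · exact ⟨⟨x, pp_x h, rfl⟩, ⟨x, pp_x hs, rfl⟩⟩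
      · exact ⟨⟨y, pp_y h, rfl⟩, ⟨y, pp_y hs, rfl⟩⟩
  have hun : IccR (· ≤ ·) (q x) (q y) = q '' P₁ ∪ q '' P₂ := by
    rw [← hq.icc h.1, h.2.2.2.2.1, Set.image_union]
  refine ⟨hq.mono h.1, hM1, hM2, ?_, hun, hint, ?_⟩
  · intro he
    obtain ⟨z, hz, hzx, hzy⟩ := pp_int h
    have : q z ∈ q '' P₁ ∩ q '' P₂ := by
      rw [← he]; exact ⟨⟨z, hz, rfl⟩, ⟨z, hz, rfl⟩⟩
    rw [hint] at this
    rcases this with h' | h'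
    · exact (h1 z hz hzx hzy).1 h'
    · exact (h1 z hz hzx hzy).2 h'
  · intro C hC
    by_cases hc1 : C ⊆ q '' P₁
    · exact Or.inl (hC.2.2 _ hM1.1 hM1.2.1 hc1)
    by_cases hc2 : C ⊆ q '' P₂
    · exact Or.inr (hC.2.2 _ hM2.1 hM2.2.1 hc2)
    exfalso
    obtain ⟨u, hu, hu1⟩ := Set.not_subset.1 hc1
    obtain ⟨v, hv, hv2⟩ := Set.not_subset.1 hc2
    have hu2 : u ∈ q '' P₂ := by
      have := hC.1 hu
      rw [hun] at this
      exact this.resolve_left hu1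
    have hv1 : v ∈ q '' P₁ := by
      have := hC.1 hv
      rw [hun] at this
      exact this.resolve_right hv2
    obtain ⟨w, hw, rfl⟩ := hu2
    obtain ⟨z, hz, rfl⟩ := hv1
    refine hle z hz w hw ?_ ?_ ?_ ?_ (hC.2.1.total hv hu)
    · rintro rfl; exact hv2 ⟨z, pp_x hs, rfl⟩
    · rintro rfl; exact hv2 ⟨z, pp_y hs, rfl⟩
    · rintro rfl; exact hu1 ⟨w, pp_x h, rfl⟩
    · rintro rfl; exact hu1 ⟨w, pp_y h, rfl⟩

variable {C C' : Set L}

theorem QH.mv_eq (hq : QH q) (h : Mv x y P₁ P₂ C C') (he : q '' P₁ = q '' P₂) :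
    q '' C = q '' C' := by
  have aux : ∀ {P₁ P₂ C C' : Set L}, Mv x y P₁ P₂ C C' → q '' P₁ = q '' P₂ →
      q '' C ⊆ q '' C' := by
    rintro P₁ P₂ C C' h he _ ⟨c, hc, rfl⟩
    by_cases hP : c ∈ P₁
    · exact Set.image_mono h.2.2.1 (he ▸ ⟨c, hP, rfl⟩)
    · have : c ∈ C \ P₁ := ⟨hc, hP⟩
      rw [h.2.2.2] at this
      exact ⟨c, this.1, rfl⟩
  exact Set.Subset.antisymm (aux h he) (aux h.symm he.symm)

theorem QH.mv_img (hq : QH q) (h : Mv x y P₁ P₂ C C') (hC : IsMaxChain (· ≤ ·) C)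
    (hp : IsPolygonPair (· ≤ ·) (q x) (q y) (q '' P₁) (q '' P₂)) :
    Mv (q x) (q y) (q '' P₁) (q '' P₂) (q '' C) (q '' C') := by
  have aux : ∀ {P₁ P₂ C C' : Set L}, Mv x y P₁ P₂ C C' → IsMaxChain (· ≤ ·) C →
      q '' C \ q '' P₁ ⊆ q '' C' \ q '' P₂ := by
    rintro P₁ P₂ C C' h hC _ ⟨⟨c, hc, rfl⟩, hn⟩
    have hP : c ∉ P₁ := fun hP => hn ⟨c, hP, rfl⟩
    have hm : c ∈ C \ P₁ := ⟨hc, hP⟩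
    rw [h.2.2.2] at hm
    refine ⟨⟨c, hm.1, rfl⟩, ?_⟩
    rintro ⟨w, hw, hwc⟩
    have hwl := pp_le (pp_symm h.1) hw
    rcases h.out hC.1 hc hP with h' | h'
    · exact hn ⟨x, pp_x h.1, le_antisymm (hwc ▸ hq.mono hwl.1) (hq.mono h')⟩
    · exact hn ⟨y, pp_y h.1, le_antisymm (hq.mono h') (hwc ▸ hq.mono hwl.2)⟩
  exact ⟨hp, Set.image_mono h.2.1, Set.image_mono h.2.2.1,
    Set.Subset.antisymm (aux h hC) (aux h.symm (h.max hC))⟩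

theorem QH.mv_cases [Finite L] (hq : QH q) (h : Mv x y P₁ P₂ C C') (hC : IsMaxChain (· ≤ ·) C) :
    q '' C = q '' C' ∨ Mv (q x) (q y) (q '' P₁) (q '' P₂) (q '' C) (q '' C') := by
  by_cases h1 : ∀ z ∈ P₁, z ≠ x → z ≠ y → q z ≠ q x ∧ q z ≠ q y
  · by_cases h2 : ∀ z ∈ P₂, z ≠ x → z ≠ y → q z ≠ q x ∧ q z ≠ q y
    · exact Or.inr (hq.mv_img h hC (hq.noncollapse h.1 h1 h2))
    · push Not at h2
      obtain ⟨z, hz, hzx, hzy, h2⟩ := h2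
      have := hq.collapse (pp_symm h.1) hz hzx hzy (by tauto)
      exact Or.inl (hq.mv_eq h (this.2.trans this.1.symm))
  · push Not at h1
    obtain ⟨z, hz, hzx, hzy, h2⟩ := h1
    have := hq.collapse h.1 hz hzx hzy (by tauto)
    exact Or.inl (hq.mv_eq h (this.1.trans this.2.symm))

theorem QH.edge [Finite L] (hq : QH q) (hP : MaxChainIn (· ≤ ·) (IccR (· ≤ ·) x y) P₁) {A B : M}
    (hA : A ∈ q '' P₁) (hB : B ∈ q '' P₁) (hAB : A ⋖ B) :
    ∃ a ∈ P₁, ∃ b ∈ P₁, a ⋖ b ∧ q a = A ∧ q b = B ∧ ∀ c ∈ P₁, c ≤ a ∨ b ≤ c := by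
  obtain ⟨a₀, ha₀, rfl⟩ := hA
  obtain ⟨b₀, hb₀, rfl⟩ := hB
  obtain ⟨a, ha, hqa, hl⟩ := chain_last hP.2.1 (fun z => q z ≤ q a₀) ha₀ le_rfl
  have haa : a₀ ≤ a := hl a₀ ha₀ le_rfl
  have hab0 : a < b₀ := by
    have hnle : ¬ b₀ ≤ a := fun hle => hAB.lt.not_ge ((hq.mono hle).trans hqa)
    exact lt_of_le_not_ge ((hP.2.1.total ha hb₀).resolve_right hnle) hnle
  obtain ⟨b, hb, hab, hn⟩ := chain_next hP.2.1 hb₀ hab0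
  have hnn : ∀ c ∈ P₁, c ≤ a ∨ b ≤ c := fun c hc => by
    rcases hP.2.1.total hc ha with h | h
    · exact Or.inl h
    · rcases h.eq_or_lt with h | h
      · exact Or.inl h.ge
      · exact Or.inr (hn c hc h)
  refine ⟨a, ha, b, hb, mci_cov (icc_conv x y) hP ha hb hab hnn,
    le_antisymm hqa (hq.mono haa), ?_, hnn⟩
  have h1 : q a₀ ≤ q b := hq.mono (haa.trans hab.le)
  have h2 : q b ≤ q b₀ := hq.mono (hn b₀ hb₀ hab0)
  rcases hAB.eq_or_eq h1 h2 with h | h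
  · exact absurd (hl b hb h.le) hab.not_ge
  · exact h

theorem QH.asc [Finite L] (hq : QH q) {E : Type*} {lab : L → L → E} {lab' : M → M → E}
    (hcompat : ∀ x y : L, x ⋖ y → q x ⋖ q y → lab' (q x) (q y) = lab x y)
    {lt : E → E → Prop} (hP : MaxChainIn (· ≤ ·) (IccR (· ≤ ·) x y) P₁)
    (h : ChainAscending (· ≤ ·) lab lt P₁) : ChainAscending (· ≤ ·) lab' lt (q '' P₁) := by
  intro A B C D hA hB hC hD hAB hCD hBC
  rw [covR_iff] at hAB hCD
  obtain ⟨a, ha, b, hb, hab, rfl, rfl, hn⟩ := hq.edge hP hA hB hAB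
  obtain ⟨c, hc, d, hd, hcd, rfl, rfl, _⟩ := hq.edge hP hC hD hCD
  rw [hcompat a b hab hAB, hcompat c d hcd hCD]
  refine h a b c d ha hb hc hd (covR_iff.2 hab) (covR_iff.2 hcd) ?_
  rcases hn c hc with h | h
  · exact absurd (hBC.trans (hq.mono h)) hAB.lt.not_ge
  · exact h

theorem QH.step [Finite L] [Finite M] (hq : QH q) {E : Type*} {lab : L → L → E}
    {lab' : M → M → E}
    (hcompat : ∀ x y : L, x ⋖ y → q x ⋖ q y → lab' (q x) (q y) = lab x y)
    {lt : E → E → Prop} (hC : IsMaxChain (· ≤ ·) C)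
    (h : SquareMove (· ≤ ·) C C' ∨ IncPolygonMove (· ≤ ·) lab lt C C') :
    MGPre (· ≤ ·) lab' lt (q '' C) (q '' C') := by
  rw [sqm_iff, inc_iff] at h
  rcases h with ⟨x, y, P₁, P₂, hm, hcard⟩ | ⟨x, y, P₁, P₂, hm, hcard, hasc⟩
  · rcases hq.mv_cases hm hC with he | hm'
    · rw [he]; exact .refl
    · have h1 := pp_card hm'.1
      have h2 : (IccR (· ≤ ·) (q x) (q y)).ncard ≤ 4 := by
        rw [← hq.icc hm.1.1, ← hcard]
        exact Set.ncard_image_le (Set.toFinite _)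
      exact sq_pre (.single (sqm_iff.2 ⟨_, _, _, _, hm', le_antisymm h2 h1⟩))
  · rcases hq.mv_cases hm hC with he | hm'
    · rw [he]; exact .refl
    · by_cases h4 : (IccR (· ≤ ·) (q x) (q y)).ncard = 4
      · exact sq_pre (.single (sqm_iff.2 ⟨_, _, _, _, hm', h4⟩))
      · exact .single (Or.inr (inc_iff.2 ⟨_, _, _, _, hm', h4, hq.asc hcompat hm.1.2.1 hasc⟩))

theorem QH.pre [Finite L] [Finite M] (hq : QH q) {E : Type*} {lab : L → L → E}
    {lab' : M → M → E}
    (hcompat : ∀ x y : L, x ⋖ y → q x ⋖ q y → lab' (q x) (q y) = lab x y)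
    {lt : E → E → Prop} (hC : IsMaxChain (· ≤ ·) C)
    (h : MGPre (· ≤ ·) lab lt C C') :
    MGPre (· ≤ ·) lab' lt (q '' C) (q '' C') := by
  have h' := pre_iff.1 h
  clear h
  induction h' with
  | refl => exact .refl
  | tail h1 h2 ih => exact ih.trans (hq.step hcompat (pre_max (pre_iff.2 h1) hC) h2)

/-- polygons spanned by two covers -/
theorem poly_up [Finite L] (hL : IsPolygonalLattice L) {x y₁ y₂ : L} (hne : y₁ ≠ y₂)
    (h1 : x ⋖ y₁) (h2 : x ⋖ y₂) :
    ∃ P₁ P₂, IsPolygonPair (· ≤ ·) x (y₁ ⊔ y₂) P₁ P₂ ∧ y₁ ∈ P₁ ∧ y₂ ∈ P₂ := by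
  obtain ⟨a, b, C₁, C₂, he, hp⟩ := hL.1 x y₁ y₂ hne h1 h2
  have hxy : x ≤ y₁ ⊔ y₂ := h1.le.trans le_sup_left
  have hax : x ∈ IccR (· ≤ ·) a b := he ▸ (⟨le_rfl, hxy⟩ : x ∈ IccR (· ≤ ·) x (y₁ ⊔ y₂))
  have hay : y₁ ⊔ y₂ ∈ IccR (· ≤ ·) a b :=
    he ▸ (⟨hxy, le_rfl⟩ : y₁ ⊔ y₂ ∈ IccR (· ≤ ·) x (y₁ ⊔ y₂))
  have hxa : a ∈ IccR (· ≤ ·) x (y₁ ⊔ y₂) := he ▸ (⟨le_rfl, hp.1⟩ : a ∈ IccR (· ≤ ·) a b)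
  have hxb : b ∈ IccR (· ≤ ·) x (y₁ ⊔ y₂) := he ▸ (⟨hp.1, le_rfl⟩ : b ∈ IccR (· ≤ ·) a b)
  obtain rfl : x = a := le_antisymm hxa.1 hax.1
  obtain rfl : y₁ ⊔ y₂ = b := le_antisymm hay.2 hxb.2
  have hy1 : y₁ ∈ C₁ ∪ C₂ := by rw [← hp.2.2.2.2.1]; exact ⟨h1.le, le_sup_left⟩
  have hy2 : y₂ ∈ C₁ ∪ C₂ := by rw [← hp.2.2.2.2.1]; exact ⟨h2.le, le_sup_right⟩
  have hnc : ¬ (y₁ ≤ y₂ ∨ y₂ ≤ y₁) := by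
    rintro (h | h)
    · rcases h2.eq_or_eq h1.le h with h | h
      · exact h1.lt.ne' h
      · exact hne h
    · rcases h1.eq_or_eq h2.le h with h | h
      · exact h2.lt.ne' h
      · exact hne h.symm
  rcases hy1 with hy1 | hy1
  · refine ⟨C₁, C₂, hp, hy1, hy2.resolve_left fun h => hnc (hp.2.1.2.1.total hy1 h)⟩
  · refine ⟨C₂, C₁, pp_symm hp, hy1, hy2.resolve_right fun h => hnc (hp.2.2.1.2.1.total hy1 h)⟩

theorem QH.cover_lift [Finite L] (hq : QH q) {x : L} (hx : ∀ z, q z = q x → z ≤ x) {y' : M}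
    (h : q x ⋖ y') : ∃ y, x ⋖ y ∧ q y = y' := by
  obtain ⟨c, rfl⟩ := hq.surj y'
  have hqc : q (c ⊔ x) = q c := by rw [hq.sup, sup_eq_left.2 h.le]
  have hlt : x < c ⊔ x := lt_of_le_of_ne le_sup_right fun he => by
    rw [← he] at hqc; exact h.lt.ne hqc
  obtain ⟨y, hxy, hyc⟩ := exists_covBy_le_of_lt hlt
  refine ⟨y, hxy, ?_⟩
  rcases h.eq_or_eq (hq.mono hxy.le) ((hq.mono hyc).trans hqc.le) with h' | h'
  · exact absurd (hx y h') hxy.lt.not_ge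
  · exact h'

theorem QH.mv_lift [Finite L] [Finite M] [Nonempty L] (hq : QH q) (hL : IsPolygonalLattice L)
    {x' y' : M} {P₁' P₂' D D' : Set M} (h : Mv x' y' P₁' P₂' D D') (hD : IsMaxChain (· ≤ ·) D) :
    ∃ x y P₁ P₂ C C', Mv x y P₁ P₂ C C' ∧ IsMaxChain (· ≤ ·) C ∧ IsMaxChain (· ≤ ·) C' ∧
      q x = x' ∧ q y = y' ∧ q '' P₁ = P₁' ∧ q '' P₂ = P₂' ∧ q '' C = D ∧ q '' C' = D' := by
  obtain ⟨x₀, hx₀⟩ := hq.surj x'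
  obtain ⟨x, _, hxm⟩ := Finite.exists_le_maximal (p := fun z : L => q z = x') hx₀
  obtain rfl := hxm.1
  have hxt : ∀ z, q z = q x → z ≤ x := fun z hz => by
    have : q (z ⊔ x) = q x := by rw [hq.sup, hz, sup_idem]
    exact le_sup_left.trans (hxm.2 this le_sup_right)
  have hs := pp_symm h.1
  obtain ⟨y₁', hy₁', hc1, hn1⟩ := pp_atom h.1
  obtain ⟨y₂', hy₂', hc2, hn2⟩ := pp_atom hs
  obtain ⟨y₁, hy1, rfl⟩ := hq.cover_lift hxt hc1
  obtain ⟨y₂, hy2, rfl⟩ := hq.cover_lift hxt hc2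
  have hne : y₁ ≠ y₂ := by
    rintro rfl
    rcases pp_inter h.1 hy₁' hy₂' with h | h
    · exact hc1.lt.ne' h
    · exact hn1 h
  obtain ⟨P₁, P₂, hp, hm1, hm2⟩ := poly_up hL hne hy1 hy2
  have hqy : q (y₁ ⊔ y₂) = y' := by
    rw [hq.sup, pp_sup h.1 hy₁' hy₂' hc1.lt.ne' hc2.lt.ne']
  have e1 : q '' P₁ = P₁' := by
    have := hq.img_icc hp.1 hp.2.1
    rw [hqy] at this
    rcases h.1.2.2.2.2.2.2 _ this with h' | h'
    · exact h'
    · exfalso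
      have h3 : q y₁ ∈ P₂' := h' ▸ ⟨y₁, hm1, rfl⟩
      rcases pp_inter h.1 hy₁' h3 with h | h
      · exact hc1.lt.ne' h
      · exact hn1 h
  have e2 : q '' P₂ = P₂' := by
    have := hq.img_icc hp.1 hp.2.2.1
    rw [hqy] at this
    rcases h.1.2.2.2.2.2.2 _ this with h' | h'
    · exfalso
      have h3 : q y₂ ∈ P₁' := h' ▸ ⟨y₂, hm2, rfl⟩
      rcases pp_inter h.1 h3 hy₂' with h | h
      · exact hc2.lt.ne' h
      · exact hn2 h
    · exact h'
  obtain ⟨C, hC, hqC, hPC⟩ := hq.lift hD hp.2.1.2.1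
    (fun z hz => h.2.1 (e1 ▸ ⟨z, hz, rfl⟩))
  have hmv := Mv.exists hp hC.1 hPC
  refine ⟨x, y₁ ⊔ y₂, P₁, P₂, C, _, hmv, hC, hmv.max hC, rfl, hqy, e1, e2, hqC, ?_⟩
  have h3 := hq.mv_img hmv hC (by rw [hqy, e1, e2]; exact h.1)
  rw [e1, e2, hqC] at h3
  have h4 : ∀ {A : Set M}, P₂' ⊆ A → A = (A \ P₂') ∪ P₂' := fun hA => by
    rw [Set.sdiff_union_of_subset hA]
  rw [h4 h3.2.2.1, ← h3.2.2.2, h.2.2.2, ← h4 h.2.2.1]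

variable {E : Type*} [PartialOrder E] {lab : L → L → E}

theorem mv_comp (hpl : PolygonalLabelling lab) (h : Mv x y P₁ P₂ C C') :
    MGPre (· ≤ ·) lab (· < ·) C C' ∨ MGPre (· ≤ ·) lab (· < ·) C' C := by
  by_cases h4 : (IccR (α := L) (· ≤ ·) x y).ncard = 4
  · exact Or.inl (sq_pre (.single (sqm_iff.2 ⟨_, _, _, _, h, h4⟩)))
  · rcases hpl x y P₁ P₂ h.1 h4 with h' | h'
    · exact Or.inl (.single (Or.inr (inc_iff.2 ⟨_, _, _, _, h, h4, h'.1⟩)))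
    · exact Or.inr (.single (Or.inr (inc_iff.2 ⟨_, _, _, _, h.symm, h4, h'.1⟩)))

/-- fibre relation -/
def FR (q : L → M) (lab : L → L → E) (D : Set M) (A B : Set L) : Prop :=
  (IsMaxChain (· ≤ ·) A ∧ q '' A = D) ∧ (IsMaxChain (· ≤ ·) B ∧ q '' B = D) ∧
    (MGPre (· ≤ ·) lab (· < ·) A B ∨ MGPre (· ≤ ·) lab (· < ·) B A)

theorem agree {A C : Set L} (hA : IsMaxChain (· ≤ ·) A) (hC : IsMaxChain (· ≤ ·) C) {x : L}
    (hx : x ∈ C) (h : ∀ z ∈ C, z ≤ x → z ∈ A) : ∀ z, z ≤ x → (z ∈ A ↔ z ∈ C) := by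
  intro z hz
  refine ⟨fun hzA => mc_mem hC fun c hc => ?_, fun hzC => h z hzC hz⟩
  rcases hC.1.total hc hx with h' | h'
  · exact hA.1.total (h c hc h') hzA
  · exact Or.inr (hz.trans h')

theorem QH.fibre [Finite L] [Nonempty L] (hq : QH q) (hL : IsPolygonalLattice L)
    (hpl : PolygonalLabelling lab) {D : Set M} (hD : IsMaxChain (· ≤ ·) D) (x : L) :
    ∀ C C' : Set L, IsMaxChain (· ≤ ·) C → IsMaxChain (· ≤ ·) C' → q '' C = D → q '' C' = D →
      x ∈ C → x ∈ C' → (∀ z, z ≤ x → (z ∈ C ↔ z ∈ C')) →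
      Relation.ReflTransGen (FR q lab D) C C' := by
  induction x using WellFoundedGT.induction with
  | ind x ih =>
  intro C C' hC hC' hqC hqC' hxC hxC' hag
  obtain ⟨b, t, hbt⟩ := bot_top L
  have htop : ∀ A : Set L, IsMaxChain (· ≤ ·) A → t ∈ A := fun A hA =>
    mc_mem hA fun c _ => Or.inl (hbt c).2
  by_cases hxt : x = t
  · have : C = C' := by
      ext z
      exact hag z (hxt ▸ (hbt z).2)
    rw [this]
  have hlt : x < t := lt_of_le_of_ne (hbt x).2 hxt
  have hconv : ∀ a ∈ (Set.univ : Set L), ∀ b ∈ (Set.univ : Set L), ∀ z, a ≤ z → z ≤ b →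
    z ∈ (Set.univ : Set L) := fun _ _ _ _ _ _ _ => trivial
  obtain ⟨y₁, hy1, hc1⟩ := mci_next hconv (imc_iff.1 hC) hxC (htop C hC) hlt
  obtain ⟨y₂, hy2, hc2⟩ := mci_next hconv (imc_iff.1 hC') hxC' (htop C' hC') hlt
  have hdown : ∀ {A : Set L} {y : L}, IsMaxChain (· ≤ ·) A → x ∈ A → x ⋖ y →
      ∀ z ∈ A, z ≤ y → z ≤ x ∨ z = y := by
    intro A y hA hx hxy z hz hzy
    rcases hA.1.total hz hx with h | h
    · exact Or.inl h
    · rcases hxy.eq_or_eq h hzy with h | h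
      · exact Or.inl h.le
      · exact Or.inr h
  by_cases hne : y₁ = y₂
  · subst hne
    refine ih y₁ hc1.lt C C' hC hC' hqC hqC' hy1 hy2 (agree hC hC' hy2 fun z hz hzy => ?_)
    rcases hdown hC' hxC' hc2 z hz hzy with h | rfl
    · exact (hag z h).2 hz
    · exact hy1
  obtain ⟨P₁, P₂, hp, hm1, hm2⟩ := poly_up hL hne hc1 hc2
  have hnx : q x ∈ D := hqC ▸ ⟨x, hxC, rfl⟩
  have hn1 : q y₁ ∈ D := hqC ▸ ⟨y₁, hy1, rfl⟩
  have hn2 : q y₂ ∈ D := hqC' ▸ ⟨y₂, hy2, rfl⟩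
  have hint : y₁ ⊓ y₂ = x := by
    rcases hc1.eq_or_eq (le_inf hc1.le hc2.le) (inf_le_left (b := y₂)) with h | h
    · exact h
    · exfalso
      rcases hc2.eq_or_eq hc1.le (inf_eq_left.1 h) with h | h
      · exact hc1.lt.ne' h
      · exact hne h
  have hny1 : y₁ ≠ y₁ ⊔ y₂ := fun h => by
    have : y₂ ≤ y₁ := sup_eq_left.1 h.symm
    rw [inf_eq_right.2 this] at hint
    exact hc2.lt.ne' hint
  have hny2 : y₂ ≠ y₁ ⊔ y₂ := fun h => by
    have : y₁ ≤ y₂ := sup_eq_right.1 h.symm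
    rw [inf_eq_left.2 this] at hint
    exact hc1.lt.ne' hint
  have hqi : q x = q y₁ ⊓ q y₂ := by rw [← hq.inf, hint]
  have hcol : q '' P₁ = {q x, q (y₁ ⊔ y₂)} ∧ q '' P₂ = {q x, q (y₁ ⊔ y₂)} ∧ q (y₁ ⊔ y₂) ∈ D := by
    rcases hD.1.total hn1 hn2 with h | h
    · have h3 := hq.collapse hp hm1 hc1.lt.ne' hny1 (Or.inl (by rw [hqi, inf_eq_left.2 h]))
      refine ⟨h3.1, h3.2, ?_⟩
      rw [hq.sup, sup_eq_right.2 h]; exact hn2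
    · have h3 := hq.collapse (pp_symm hp) hm2 hc2.lt.ne' hny2
        (Or.inl (by rw [hqi, inf_eq_right.2 h]))
      refine ⟨h3.2, h3.1, ?_⟩
      rw [hq.sup, sup_eq_left.2 h]; exact hn1
  obtain ⟨hcol1, hcol2, hqy⟩ := hcol
  obtain ⟨A, hA, hqA, hsub⟩ := hq.lift (P := {z | z ∈ C ∧ z ≤ x} ∪ P₁) hD
    (by
      rintro u (hu | hu) v (hv | hv) _
      · exact hC.1.total hu.1 hv.1
      · exact Or.inl (hu.2.trans (pp_le hp hv).1)
      · exact Or.inr (hv.2.trans (pp_le hp hu).1)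
      · exact hp.2.1.2.1.total hu hv)
    (by
      rintro z (hz | hz)
      · exact hqC ▸ ⟨z, hz.1, rfl⟩
      · have : q z ∈ q '' P₁ := ⟨z, hz, rfl⟩
        rw [hcol1] at this
        rcases this with h | h
        · rw [h]; exact hnx
        · rw [h]; exact hqy)
  have hPA : P₁ ⊆ A := fun z hz => hsub (Or.inr hz)
  have hmv := Mv.exists hp hA.1 hPA
  generalize (A \ P₁) ∪ P₂ = B at hmv
  have hB := hmv.max hA
  have hqB : q '' B = D := by rw [← hq.mv_eq hmv (hcol1.trans hcol2.symm), hqA]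
  have s1 : Relation.ReflTransGen (FR q lab D) C A := by
    refine ih y₁ hc1.lt C A hC hA hqC hqA hy1 (hPA hm1) fun z hz =>
      (agree hA hC hy1 (fun z hz hzy => ?_) z hz).symm
    rcases hdown hC hxC hc1 z hz hzy with h | rfl
    · exact hsub (Or.inl ⟨hz, h⟩)
    · exact hPA hm1
  have s2 : Relation.ReflTransGen (FR q lab D) B C' := by
    refine ih y₂ hc2.lt B C' hB hC' hqB hqC' (hmv.2.2.1 hm2) hy2
      (agree hB hC' hy2 (fun z hz hzy => ?_))
    rcases hdown hC' hxC' hc2 z hz hzy with h | rfl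
    · have hzA : z ∈ A := hsub (Or.inl ⟨(hag z h).2 hz, h⟩)
      by_cases hzP : z ∈ P₁
      · rw [le_antisymm h (pp_le hp hzP).1]
        exact hmv.2.2.1 (pp_x (pp_symm hp))
      · have : z ∈ A \ P₁ := ⟨hzA, hzP⟩
        rw [hmv.2.2.2] at this
        exact this.1
    · exact hmv.2.2.1 hm2
  exact (s1.tail ⟨⟨hA, hqA⟩, ⟨hB, hqB⟩, mv_comp hpl hmv⟩).trans s2

theorem QH.fibre' [Finite L] [Nonempty L] (hq : QH q) (hL : IsPolygonalLattice L)
    (hpl : PolygonalLabelling lab) {D : Set M} (hD : IsMaxChain (· ≤ ·) D) {C C' : Set L}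
    (hC : IsMaxChain (· ≤ ·) C) (hC' : IsMaxChain (· ≤ ·) C') (h : q '' C = D)
    (h' : q '' C' = D) : Relation.ReflTransGen (FR q lab D) C C' := by
  obtain ⟨b, t, hbt⟩ := bot_top L
  have hbot : ∀ A : Set L, IsMaxChain (· ≤ ·) A → b ∈ A := fun A hA =>
    mc_mem hA fun c _ => Or.inr (hbt c).1
  refine hq.fibre hL hpl hD b C C' hC hC' h h' (hbot C hC) (hbot C' hC') fun z hz => ?_
  rw [le_antisymm hz (hbt z).1]
  exact iff_of_true (hbot C hC) (hbot C' hC')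

/-- class relation -/
def CR (q : L → M) (lab : L → L → E) (lab' : M → M → E) (D : Set M) (A B : Set L) : Prop :=
  (IsMaxChain (· ≤ ·) A ∧ MGPre (· ≤ ·) lab' (· < ·) (q '' A) D ∧
    MGPre (· ≤ ·) lab' (· < ·) D (q '' A)) ∧
  (IsMaxChain (· ≤ ·) B ∧ MGPre (· ≤ ·) lab' (· < ·) (q '' B) D ∧
    MGPre (· ≤ ·) lab' (· < ·) D (q '' B)) ∧
  (MGPre (· ≤ ·) lab (· < ·) A B ∨ MGPre (· ≤ ·) lab (· < ·) B A)

theorem QH.conn [Finite L] [Finite M] [Nonempty L] (hq : QH q) (hL : IsPolygonalLattice L)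
    (hpl : PolygonalLabelling lab) {lab' : M → M → E} {D X Y : Set M}
    (hX : IsMaxChain (· ≤ ·) X)
    (hDX : MGPre (· ≤ ·) lab' (· < ·) D X) (hXY : MGPre (· ≤ ·) lab' (· < ·) X Y) :
    MGPre (· ≤ ·) lab' (· < ·) Y D → ∀ A B : Set L,
      IsMaxChain (· ≤ ·) A → IsMaxChain (· ≤ ·) B → q '' A = X → q '' B = Y →
      Relation.ReflTransGen (CR q lab lab' D) A B := by
  have hfib : ∀ {Z : Set M}, IsMaxChain (· ≤ ·) Z → MGPre (· ≤ ·) lab' (· < ·) D Z →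
      MGPre (· ≤ ·) lab' (· < ·) Z D → ∀ {A B : Set L},
      IsMaxChain (· ≤ ·) A → IsMaxChain (· ≤ ·) B → q '' A = Z → q '' B = Z →
      Relation.ReflTransGen (CR q lab lab' D) A B := by
    intro Z hZ h1 h2 A B hA hB hqA hqB
    refine Relation.ReflTransGen.mono ?_ _ _ (hq.fibre' hL hpl hZ hA hB hqA hqB)
    rintro A B ⟨⟨h3, rfl⟩, ⟨h4, h5⟩, h6⟩
    exact ⟨⟨h3, h2, h1⟩, ⟨h4, h5 ▸ h2, h5 ▸ h1⟩, h6⟩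
  have h' := pre_iff.1 hXY
  clear hXY
  induction h' with
  | refl =>
    intro hXD A B hA hB hqA hqB
    exact hfib hX hDX hXD hA hB hqA hqB
  | @tail Y Z h1 h2 ih =>
    intro hZD A B hA hB hqA hqB
    have hXY := pre_iff.2 h1
    have hY := pre_max hXY hX
    have hYZ : MGPre (· ≤ ·) lab' (· < ·) Y Z := pre_iff.2 (.single h2)
    have hZ := pre_max hYZ hY
    have hDY := hDX.trans hXY
    have hmv : ∃ x y P₁ P₂, Mv x y P₁ P₂ Y Z := by
      rw [sqm_iff, inc_iff] at h2
      rcases h2 with ⟨x, y, P₁, P₂, hm, _⟩ | ⟨x, y, P₁, P₂, hm, _⟩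
      · exact ⟨x, y, P₁, P₂, hm⟩
      · exact ⟨x, y, P₁, P₂, hm⟩
    obtain ⟨x', y', P₁', P₂', hm⟩ := hmv
    obtain ⟨x, y, P₁, P₂, C, C', hm', hC, hC', _, _, _, _, hqC, hqC'⟩ := hq.mv_lift hL hm hY
    have s1 := ih (hYZ.trans hZD) A C hA hC hqA hqC
    have s3 := hfib hZ (hDY.trans hYZ) hZD hC' hB hqC' hqB
    refine (s1.tail ⟨⟨hC, ?_, ?_⟩, ⟨hC', ?_, ?_⟩, mv_comp hpl hm'⟩).trans s3
    · rw [hqC]; exact hYZ.trans hZD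
    · rw [hqC]; exact hDY
    · rw [hqC']; exact hZD
    · rw [hqC']; exact hDY.trans hYZ

/-- finding the inc move in a cover -/
theorem cover_step {lab' : M → M → E} {D D' : Set M} (hD : IsMaxChain (· ≤ ·) D)
    (h : MGCover (· ≤ ·) lab' (· < ·) D D') :
    ∃ A B, IsMaxChain (· ≤ ·) A ∧ SqEquiv (· ≤ ·) A D ∧ SqEquiv (· ≤ ·) B D' ∧
      IncPolygonMove (· ≤ ·) lab' (· < ·) A B := by
  obtain ⟨h1, h2, h3⟩ := h
  have key : ∀ Z, MGPre (· ≤ ·) lab' (· < ·) D Z → MGPre (· ≤ ·) lab' (· < ·) Z D' →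
      SqEquiv (· ≤ ·) Z D ∨ ∃ A B, IsMaxChain (· ≤ ·) A ∧ SqEquiv (· ≤ ·) A D ∧
        SqEquiv (· ≤ ·) B D' ∧ IncPolygonMove (· ≤ ·) lab' (· < ·) A B := by
    intro Z hZ
    induction hZ with
    | refl => intro _; exact Or.inl .refl
    | @tail Y Z hY hstep ih =>
      intro hZD
      have hYZ : MGPre (· ≤ ·) lab' (· < ·) Y Z := .single hstep
      rcases ih (hYZ.trans hZD) with h | h
      · have hYm := pre_max hY hD
        rcases hstep with hs | hs
        · exact Or.inl ((sq_symm hs).trans h)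
        · rcases h3 Z (inc_max hs hYm) (Relation.ReflTransGen.trans hY hYZ) hZD with h4 | h4
          · exact Or.inl h4
          · exact Or.inr ⟨Y, Z, hYm, h, h4, hs⟩
      · exact Or.inr h
  rcases key D' h1 .refl with h | h
  · exact absurd (sq_pre h) h2
  · exact h

end Quot
/-- In the setting of a finite polygonal lattice `L` with a forcing-consistent,
polygonal and polygon-complete edge labelling `lab`, a lattice quotient
`q : L → M` realising a lattice congruence on `L`, and the quotient edge
labelling `lab'`, the induced map `[C] ↦ [q '' C]` on square-equivalence
classes of maximal chains is a contraction of preordered sets: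
it is order-preserving and surjective; the preimage of each
equivalence class `[y] = {z : y ≼ z ≼ y}` is a connected sub-preordered set;
and every covering relation of the target lifts to a covering relation of the
source. -/
theorem induced_map_contraction {L M E : Type*} [Lattice L]
    [Lattice M] [Finite L] [Finite M] [PartialOrder E] [Finite E]
    (hL : IsPolygonalLattice L) (lab : L → L → E)
    (hfc : ForcingConsistent lab) (hpl : PolygonalLabelling lab)
    (hpc : PolygonComplete (· ≤ ·) lab (· < ·))
    (q : L → M) (hsurj : Function.Surjective q)
    (hsup : ∀ x y : L, q (x ⊔ y) = q x ⊔ q y)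
    (hinf : ∀ x y : L, q (x ⊓ y) = q x ⊓ q y)
    (lab' : M → M → E)
    (hcompat : ∀ x y : L, x ⋖ y → q x ⋖ q y → lab' (q x) (q y) = lab x y) :
    -- (1) order-preserving
    (∀ C C' : Set L, IsMaxChain (· ≤ ·) C → IsMaxChain (· ≤ ·) C' →
      MGPre (· ≤ ·) lab (· < ·) C C' →
      MGPre (· ≤ ·) lab' (· < ·) (q '' C) (q '' C')) ∧
    -- (1') surjective on square-equivalence classes
    (∀ D : Set M, IsMaxChain (· ≤ ·) D →
      ∃ C : Set L, IsMaxChain (· ≤ ·) C ∧ SqEquiv (· ≤ ·) (q '' C) D) ∧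
    -- (2) preimages of equivalence classes are connected sub-preordered sets
    (∀ D : Set M, IsMaxChain (· ≤ ·) D →
      ∀ C C' : Set L, IsMaxChain (· ≤ ·) C → IsMaxChain (· ≤ ·) C' →
        (MGPre (· ≤ ·) lab' (· < ·) (q '' C) D ∧
          MGPre (· ≤ ·) lab' (· < ·) D (q '' C)) →
        (MGPre (· ≤ ·) lab' (· < ·) (q '' C') D ∧
          MGPre (· ≤ ·) lab' (· < ·) D (q '' C')) →
        Relation.ReflTransGen
          (fun A B : Set L =>
            (IsMaxChain (· ≤ ·) A ∧ MGPre (· ≤ ·) lab' (· < ·) (q '' A) D ∧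
              MGPre (· ≤ ·) lab' (· < ·) D (q '' A)) ∧
            (IsMaxChain (· ≤ ·) B ∧ MGPre (· ≤ ·) lab' (· < ·) (q '' B) D ∧
              MGPre (· ≤ ·) lab' (· < ·) D (q '' B)) ∧
            (MGPre (· ≤ ·) lab (· < ·) A B ∨ MGPre (· ≤ ·) lab (· < ·) B A))
          C C') ∧
    -- (3) covering relations lift
    (∀ D D' : Set M, IsMaxChain (· ≤ ·) D → IsMaxChain (· ≤ ·) D' →
      MGCover (· ≤ ·) lab' (· < ·) D D' →
      ∃ C C' : Set L, IsMaxChain (· ≤ ·) C ∧ IsMaxChain (· ≤ ·) C' ∧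
        MGCover (· ≤ ·) lab (· < ·) C C' ∧
        SqEquiv (· ≤ ·) (q '' C) D ∧ SqEquiv (· ≤ ·) (q '' C') D') := by
  have hq : QH q := ⟨hsurj, hsup, hinf⟩
  rcases isEmpty_or_nonempty L with hE | hE
  · have hEM : IsEmpty M := ⟨fun m => (hsurj m).elim fun a _ => hE.elim a⟩
    refine ⟨?_, ?_, ?_, ?_⟩
    · intro C C' _ _ _
      rw [Subsingleton.elim C C']; exact .refl
    · intro D _
      refine ⟨∅, ⟨Set.subsingleton_empty.isChain, fun t _ _ => Subsingleton.elim _ _⟩, ?_⟩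
      rw [Subsingleton.elim (q '' ∅) D]; exact .refl
    · intro D _ C C' _ _ _ _
      rw [Subsingleton.elim C C']
    · intro D D' _ _ h
      rw [Subsingleton.elim D D'] at h
      exact absurd .refl h.2.1
  refine ⟨?_, ?_, ?_, ?_⟩
  · intro C C' hC _ h
    exact hq.pre hcompat hC h
  · intro D hD
    obtain ⟨C, hC, hqC, _⟩ := hq.lift (P := ∅) hD Set.subsingleton_empty.isChain
      (fun z hz => hz.elim)
    exact ⟨C, hC, by rw [hqC]; exact .refl⟩
  · intro D hD C C' hC hC' h h'
    obtain ⟨C₀, hC₀, hqC₀, _⟩ := hq.lift (P := ∅) hD Set.subsingleton_empty.isChain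
      (fun z hz => hz.elim)
    have s1 := hq.conn hL hpl (hq.img_max hC) h.2 h.1 .refl C C₀ hC hC₀ rfl hqC₀
    have s2 := hq.conn hL hpl hD .refl h'.2 h'.1 C₀ C' hC₀ hC' hqC₀ rfl
    exact s1.trans s2
  · intro D D' hD hD' h
    obtain ⟨A, B, hA, hAD, hBD, hinc⟩ := cover_step hD h
    obtain ⟨x', y', P₁', P₂', hm, hcard, hasc⟩ := inc_iff.1 hinc
    obtain ⟨x, y, P₁, P₂, C, C', hm', hC, hC', rfl, rfl, rfl, rfl, rfl, rfl⟩ :=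
      hq.mv_lift hL hm hA
    have hcard' : (IccR (α := L) (· ≤ ·) x y).ncard ≠ 4 := by
      intro h4
      have h5 := pp_card hm.1
      have h6 : (IccR (· ≤ ·) (q x) (q y)).ncard ≤ 4 := by
        rw [← hq.icc hm'.1.1, ← h4]
        exact Set.ncard_image_le (Set.toFinite _)
      exact hcard (le_antisymm h6 h5)
    refine ⟨C, C', hC, hC', hpc C C' hC hC' (inc_iff.2 ⟨x, y, P₁, P₂, hm', hcard', ?_⟩), hAD, hBD⟩
    rcases hpl x y P₁ P₂ hm'.1 hcard' with h7 | h7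
    · exact h7.1
    · exfalso
      have h8 := hq.asc hcompat hm'.1.2.1 h7.2
      obtain ⟨a, b, c, ha, hb, hc, hab, hbc⟩ := pp_edges hm.1
      have h9 := h8 a b b c ha hb hb hc (covR_iff.2 hab) (covR_iff.2 hbc) le_rfl
      have h10 := hasc a b b c ha hb hb hc (covR_iff.2 hab) (covR_iff.2 hbc) le_rfl
      exact lt_asymm h9 h10
end

section
/- Let (W, S) be a finite Coxeter system with longest element w₀. Two reduced words ω and ω' for w₀ satisfy heap(ω) = heap(ω') if and only if ω and ω' are related by a finite sequence of commutation moves. -/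
/-! Coxeter-specific definitions: the right weak order, its labelling by
reflections, commutation moves, heap posets of reduced words, and (maximal)
dihedral reflection subgroups. -/

section CoxeterDefs

variable {B : Type*} {W : Type*} [Group W] {M : CoxeterMatrix B}

/-- The right weak Bruhat order: `u ≤ w` iff `ℓ(u) + ℓ(u⁻¹ w) = ℓ(w)`. -/
def weakLE (cs : CoxeterSystem M W) (u w : W) : Prop :=
  cs.length u + cs.length (u⁻¹ * w) = cs.length w

/-- The set of labels of the covering relations of a chain `C` in the right
weak order: the covering relation `v ⋖ v s` is labelled by the reflection
`v s v⁻¹`, i.e. the cover `u ⋖ w` is labelled by `w * u⁻¹`. -/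
def chainLabels (cs : CoxeterSystem M W) (C : Set W) : Set W :=
  {t | ∃ u w : W, u ∈ C ∧ w ∈ C ∧ CovR (weakLE cs) u w ∧ t = w * u⁻¹}

/-- `ω'` is obtained from `ω` by one commutation move: swapping an adjacent
pair of commuting letters. -/
def CommMove (cs : CoxeterSystem M W) (ω ω' : List B) : Prop :=
  ∃ (l r : List B) (i j : B),
    cs.simple i * cs.simple j = cs.simple j * cs.simple i ∧
    ω = l ++ i :: j :: r ∧ ω' = l ++ j :: i :: r

/-- The strict heap order of a word `ω`: the transitive closure of the
relations `t_j < t_k` for `j < k` in the (left) inversion sequence of `ω`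
whenever `t_j` and `t_k` do not commute. -/
def heapLt (cs : CoxeterSystem M W) (ω : List B) : W → W → Prop :=
  Relation.TransGen (fun a b => ∃ j k : ℕ, j < k ∧
    (cs.leftInvSeq ω)[j]? = some a ∧ (cs.leftInvSeq ω)[k]? = some b ∧
    a * b ≠ b * a)

/-- A dihedral reflection subgroup: a subgroup generated by two reflections. -/
def IsDihedralSubgroup (cs : CoxeterSystem M W) (D : Subgroup W) : Prop :=
  ∃ t₁ t₂ : W, cs.IsReflection t₁ ∧ cs.IsReflection t₂ ∧
    D = Subgroup.closure {t₁, t₂}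

/-- A maximal dihedral reflection subgroup: maximal under inclusion among
dihedral reflection subgroups. -/
def IsMaxDihedralSubgroup (cs : CoxeterSystem M W) (D : Subgroup W) : Prop :=
  IsDihedralSubgroup cs D ∧
    ∀ D' : Subgroup W, IsDihedralSubgroup cs D' → D ≤ D' → D = D'

/-- The set of reflections of `W` contained in a subgroup `D`. -/
def reflectionsIn (cs : CoxeterSystem M W) (D : Subgroup W) : Set W :=
  {t | cs.IsReflection t ∧ t ∈ D}

/-- `D` contains two non-commuting reflections. -/
def IsNonCommutative (cs : CoxeterSystem M W) (D : Subgroup W) : Prop :=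
  ∃ t t' : W, cs.IsReflection t ∧ cs.IsReflection t' ∧ t ∈ D ∧ t' ∈ D ∧
    t * t' ≠ t' * t

/-- `t` occurs strictly before `t'` in the inversion sequence of `ω`. -/
def seqBefore (cs : CoxeterSystem M W) (ω : List B) (t t' : W) : Prop :=
  ∃ j k : ℕ, j < k ∧ (cs.leftInvSeq ω)[j]? = some t ∧
    (cs.leftInvSeq ω)[k]? = some t'

/-- `t` occurs strictly before `t'` in the label sequence of the chain `C`
of the right weak order. -/
def chainBefore (cs : CoxeterSystem M W) (C : Set W) (t t' : W) : Prop :=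
  ∃ a b c d : W, a ∈ C ∧ b ∈ C ∧ c ∈ C ∧ d ∈ C ∧
    CovR (weakLE cs) a b ∧ CovR (weakLE cs) c d ∧
    t = b * a⁻¹ ∧ t' = d * c⁻¹ ∧ weakLE cs b c

/-- The inversion set `inv_ω(C)` of a maximal chain `C`: the set of
non-commutative maximal dihedral reflection subgroups whose reflections occur
in the label sequence of `C` in a different relative order from the inversion
sequence of `ω`. -/
def invSubgroups (cs : CoxeterSystem M W) (ω : List B) (C : Set W) :
    Set (Subgroup W) :=
  {D | IsMaxDihedralSubgroup cs D ∧ IsNonCommutative cs D ∧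
    ∃ t t' : W, cs.IsReflection t ∧ cs.IsReflection t' ∧ t ∈ D ∧ t' ∈ D ∧
      seqBefore cs ω t t' ∧ chainBefore cs C t' t}

end CoxeterDefs


open Polynomial.Chebyshev in
theorem hx_refl_pow {V : Type*} [AddCommGroup V] [Module ℝ V] {x y : V} {f g : Module.Dual ℝ V}
    (hf : f x = 2) (hg : g y = 2) (m : ℕ) (hm : 2 ≤ m)
    (h1 : f y = -2 * Real.cos (Real.pi / m)) (h2 : g x = -2 * Real.cos (Real.pi / m)) :
    (Module.reflection hf * Module.reflection hg) ^ m = 1 := by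
  ext z
  rcases eq_or_lt_of_le hm with rfl | hm
  · have h1' : f y = 0 := by simp [h1]
    have h2' : g x = 0 := by simp [h2]
    simp [pow_two, Module.reflection_apply, hf, hg, h1', h2']
    module
  have hmpos : (0 : ℝ) < m := by positivity
  have hm3 : (3 : ℝ) ≤ m := by exact_mod_cast hm
  set θ : ℝ := 2 * Real.pi / m with hθ
  have ht : 2 * Real.cos θ = f y * g x - 2 := by
    rw [h1, h2, hθ, mul_div_assoc, Real.cos_two_mul]; ring
  have hs : Real.sin θ ≠ 0 := by
    apply ne_of_gt
    apply Real.sin_pos_of_pos_of_lt_pi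
    · positivity
    · rw [hθ, div_lt_iff₀ hmpos]; nlinarith [Real.pi_pos]
  rw [Module.reflection_mul_reflection_pow_apply hf hg m z (2 * Real.cos θ) ht]
  have hmθ : m * θ = 2 * Real.pi := by rw [hθ]; field_simp
  rcases Nat.even_or_odd' m with ⟨k, hk | hk⟩
  · have e1 : ((m : ℤ) - 2) / 2 = k - 1 := by omega
    have e2 : ((m : ℤ) - 1) / 2 = k - 1 := by omega
    have e0 : (S ℝ ((k : ℤ) - 1)).eval (2 * Real.cos θ) = 0 := by
      have := S_two_mul_real_cos θ (k - 1)
      have h3 : (k : ℝ) * θ = Real.pi := by rw [hk] at hmθ; push_cast at hmθ; linarith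
      push_cast at this
      rw [sub_add_cancel, h3, Real.sin_pi] at this
      exact (mul_eq_zero.1 this).resolve_right hs
    rw [e1, e2, e0]; simp
  · have e1 : ((m : ℤ) - 2) / 2 = k - 1 := by omega
    have e2 : ((m : ℤ) - 1) / 2 = k := by omega
    have e3 : ((m : ℤ) - 3) / 2 = k - 1 := by omega
    have e4 : (m : ℤ) / 2 = k := by omega
    have e0 : (S ℝ (k : ℤ)).eval (2 * Real.cos θ) + (S ℝ ((k : ℤ) - 1)).eval (2 * Real.cos θ) = 0 := by
      have a1 := S_two_mul_real_cos θ (k - 1)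
      have a2 := S_two_mul_real_cos θ k
      have h3 : ((k : ℝ) + 1) * θ = 2 * Real.pi - k * θ := by
        rw [hk] at hmθ; push_cast at hmθ; linarith
      push_cast at a1 a2
      rw [h3, Real.sin_two_pi_sub] at a2
      rw [sub_add_cancel] at a1
      refine (mul_eq_zero.1 (?_ : _ * Real.sin θ = 0)).resolve_right hs
      rw [add_mul, a1, a2]; ring
    rw [e1, e2, e3, e4, e0]; simp

theorem hx_simple_inj {B W : Type*} [Group W] {M : CoxeterMatrix B}
    (cs : CoxeterSystem M W) : Function.Injective cs.simple := by
  classical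
  intro i j hij
  by_contra hne
  let f : B → Module.Dual ℝ (B →₀ ℝ) := fun i =>
    Finsupp.linearCombination ℝ (fun j => -2 * Real.cos (Real.pi / M i j))
  have hf : ∀ i j, f i (Finsupp.single j 1) = -2 * Real.cos (Real.pi / M i j) := by
    intro i j; simp [f]
  have hd : ∀ i, f i (Finsupp.single i 1) = 2 := by
    intro i; rw [hf]; simp
  have hl : M.IsLiftable (fun i => Module.reflection (hd i)) := by
    intro i j
    rcases Nat.lt_or_ge (M i j) 2 with h | h
    · by_cases h0 : M i j = 0
      · rw [h0, pow_zero]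
      · have h1 : M i j = 1 := by omega
        have : i = j := by
          by_contra hc
          exact M.off_diagonal i j hc h1
        subst this
        rw [h1, pow_one]
        ext1 z
        exact Module.involutive_reflection (hd i) z
    · exact hx_refl_pow _ _ _ h (hf i j) (by rw [hf, M.symmetric])
  have h1 := cs.lift_apply_simple hl i
  have h2 := cs.lift_apply_simple hl j
  rw [hij] at h1
  have h3 := congrArg (fun F => F (Finsupp.single i 1) i) (h1.symm.trans h2)
  simp [Module.reflection_apply, hne] at h3
  norm_num at h3

theorem hx_lift_par {B W : Type*} [Group W] {M : CoxeterMatrix B} [DecidableEq W]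
    (cs : CoxeterSystem M W) : ∃ F : W →* Function.End (W × ZMod 2),
      ∀ i t e, F (cs.simple i) (t, e) =
        (cs.simple i * t * cs.simple i, e + if t = cs.simple i then 1 else 0) := by
  let f : B → Function.End (W × ZMod 2) := fun i p =>
    (cs.simple i * p.1 * cs.simple i, p.2 + if p.1 = cs.simple i then 1 else 0)
  have hl : M.IsLiftable f := by
    intro i j
    set r := cs.simple i * cs.simple j with hr
    have hri : r⁻¹ = cs.simple j * cs.simple i := by simp [hr]
    have key : ∀ (m : ℕ) (t : W) (e : ZMod 2), ((f i * f j) ^ m) (t, e) =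
        (r ^ m * t * (r ^ m)⁻¹, e + ∑ n ∈ Finset.range (2 * m),
          if t = (r ^ n)⁻¹ * cs.simple j then (1 : ZMod 2) else 0) := by
      intro m
      induction m with
      | zero => intro t e; simp; rfl
      | succ m ih =>
        intro t e
        have hcj : ∀ n : ℕ, cs.simple j * r ^ n = (r ^ n)⁻¹ * cs.simple j := by
          intro n
          have : cs.simple j * r * (cs.simple j)⁻¹ = r⁻¹ := by simp [hr, mul_assoc]
          have h2 : cs.simple j * r ^ n * (cs.simple j)⁻¹ = (r ^ n)⁻¹ := by
            rw [← conj_pow, this, inv_pow]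
          rw [← h2]; simp
        rw [pow_succ']
        change f i (f j (((f i * f j) ^ m) (t, e))) = _
        rw [ih]
        simp only [f]
        rw [show 2 * (m + 1) = 2 * m + 1 + 1 by ring, Finset.sum_range_succ,
          Finset.sum_range_succ]
        have q1 : (r ^ m * t * (r ^ m)⁻¹ = cs.simple j) ↔
            t = (r ^ (2 * m))⁻¹ * cs.simple j := by
          rw [mul_inv_eq_iff_eq_mul, hcj, ← eq_inv_mul_iff_mul_eq, two_mul, pow_add, mul_inv_rev,
            mul_assoc]
        have q2 : (cs.simple j * (r ^ m * t * (r ^ m)⁻¹) * cs.simple j = cs.simple i) ↔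
            t = (r ^ (2 * m + 1))⁻¹ * cs.simple j := by
          have : (cs.simple j * (r ^ m * t * (r ^ m)⁻¹) * cs.simple j = cs.simple i) ↔
            (r ^ m * t * (r ^ m)⁻¹) = r⁻¹ * cs.simple j := by
            rw [hri]
            constructor
            · intro h; rw [← h]; simp [mul_assoc]
            · intro h; rw [h]; simp [mul_assoc]
          rw [this, mul_inv_eq_iff_eq_mul, mul_assoc, hcj, ← eq_inv_mul_iff_mul_eq]
          rw [show 2 * m + 1 = m + 1 + m by ring, pow_add, pow_succ]
          simp [mul_assoc]
        ext1
        · simp [hr, pow_succ', mul_assoc]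
        · simp only [q1, q2, add_assoc]
    funext ⟨t, e⟩
    rw [key]
    have hm : r ^ (M i j) = 1 := cs.simple_mul_simple_pow i j
    rw [two_mul, Finset.sum_range_add]
    simp only [pow_add, hm, one_mul]
    rw [CharTwo.add_self_eq_zero]
    simp
    rfl
  refine ⟨cs.lift ⟨f, hl⟩, fun i t e => ?_⟩
  rw [cs.lift_apply_simple hl]

theorem hx_count {B W : Type*} [Group W] {M : CoxeterMatrix B} [DecidableEq W]
    (cs : CoxeterSystem M W) (ω ω' : List B) (h : cs.wordProd ω = cs.wordProd ω') (t : W) :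
    ((cs.rightInvSeq ω).count t : ZMod 2) = ((cs.rightInvSeq ω').count t : ZMod 2) := by
  obtain ⟨F, hF⟩ := hx_lift_par cs
  have key : ∀ (ω : List B) e, F (cs.wordProd ω) (t, e) =
      (cs.wordProd ω * t * (cs.wordProd ω)⁻¹, e + ((cs.rightInvSeq ω).count t : ZMod 2)) := by
    intro ω
    induction ω with
    | nil => intro e; simp; rfl
    | cons i ω ih =>
      intro e
      rw [cs.wordProd_cons, map_mul]
      change F (cs.simple i) (F (cs.wordProd ω) (t, e)) = _
      rw [ih, hF, CoxeterSystem.rightInvSeq, List.count_cons]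
      have q : (cs.wordProd ω * t * (cs.wordProd ω)⁻¹ = cs.simple i) ↔
        ((cs.wordProd ω)⁻¹ * cs.simple i * cs.wordProd ω = t) := by
        constructor
        · intro h; rw [← h]; group
        · intro h; rw [← h]; group
      ext1
      · simp [mul_assoc]
      · simp only [q, beq_iff_eq]; push_cast; rw [add_assoc]
  have := (key ω 0).symm.trans ((congrArg (fun w => F w (t, 0)) h).trans (key ω' 0))
  simpa using congrArg Prod.snd this

theorem hx_mem {B W : Type*} [Group W] {M : CoxeterMatrix B}
    (cs : CoxeterSystem M W) {ω ω' : List B} (hω : cs.IsReduced ω) 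
    (h : cs.wordProd ω = cs.wordProd ω') {t : W} (ht : t ∈ cs.leftInvSeq ω) :
    t ∈ cs.leftInvSeq ω' := by
  classical
  have h1 := hx_count cs ω.reverse ω'.reverse (by simp [h]) t
  rw [cs.rightInvSeq_reverse, cs.rightInvSeq_reverse, List.count_reverse, List.count_reverse,
    List.count_eq_one_of_mem hω.nodup_leftInvSeq ht] at h1
  by_contra hc
  rw [List.count_eq_zero_of_not_mem hc] at h1
  simp at h1

theorem hx_lis_append {B W : Type*} [Group W] {M : CoxeterMatrix B}
    (cs : CoxeterSystem M W) (l r : List B) :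
    cs.leftInvSeq (l ++ r) =
      cs.leftInvSeq l ++ (cs.leftInvSeq r).map (MulAut.conj (cs.wordProd l)) := by
  induction l with
  | nil => simp
  | cons i l ih =>
    rw [List.cons_append, CoxeterSystem.leftInvSeq, ih, CoxeterSystem.leftInvSeq,
      cs.wordProd_cons]
    simp

/-- One-sided comparison of the order of non-commuting pairs. -/
def HxLe {W : Type*} [Group W] (L L' : List W) : Prop :=
  ∀ a b, a * b ≠ b * a → [a, b].Sublist L → [a, b].Sublist L'

theorem hx_le_swap {W : Type*} [Group W] (l r : List W) (x y : W) (h : x * y = y * x) :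
    HxLe (l ++ x :: y :: r) (l ++ y :: x :: r) := by
  intro a b hab
  induction l with
  | nil =>
    intro hs
    simp only [List.nil_append] at hs ⊢
    rw [List.sublist_cons_iff] at hs
    rcases hs with hs | ⟨r', hr', hs⟩
    · rw [List.sublist_cons_iff] at hs
      rcases hs with hs | ⟨r', hr', hs⟩
      · exact (hs.cons _).cons _
      · obtain ⟨rfl, rfl⟩ := List.cons_eq_cons.1 hr'
        exact (hs.cons _).cons_cons _
    · obtain ⟨rfl, rfl⟩ := List.cons_eq_cons.1 hr'
      rw [List.sublist_cons_iff] at hs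
      rcases hs with hs | ⟨r', hr', hs⟩
      · exact (hs.cons_cons _).cons _
      · obtain ⟨rfl, rfl⟩ := List.cons_eq_cons.1 hr'
        exact absurd h hab
  | cons c l ih =>
    intro hs
    simp only [List.cons_append] at hs ⊢
    rw [List.sublist_cons_iff] at hs
    rcases hs with hs | ⟨r', hr', hs⟩
    · exact (ih hs).cons _
    · obtain ⟨rfl, rfl⟩ := List.cons_eq_cons.1 hr'
      apply List.Sublist.cons_cons
      rw [List.singleton_sublist] at hs ⊢
      simp only [List.mem_append, List.mem_cons] at hs ⊢
      tauto

theorem hx_move_le {B W : Type*} [Group W] {M : CoxeterMatrix B}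
    (cs : CoxeterSystem M W) {ω ω' : List B} (h : CommMove cs ω ω') :
    HxLe (cs.leftInvSeq ω) (cs.leftInvSeq ω') := by
  obtain ⟨l, r, i, j, hij, rfl, rfl⟩ := h
  have e1 : cs.simple i * cs.simple j * cs.simple i = cs.simple j := by
    rw [hij]; simp
  have e2 : cs.simple j * cs.simple i * cs.simple j = cs.simple i := by
    rw [← hij]; simp
  have e3 : ∀ x : W, cs.simple j * (cs.simple i * x * cs.simple i) * cs.simple j =
      cs.simple i * (cs.simple j * x * cs.simple j) * cs.simple i := by
    intro x
    calc _ = (cs.simple j * cs.simple i) * x * (cs.simple i * cs.simple j) := by group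
      _ = (cs.simple i * cs.simple j) * x * (cs.simple j * cs.simple i) := by rw [hij]
      _ = _ := by group
  rw [hx_lis_append, hx_lis_append]
  simp only [CoxeterSystem.leftInvSeq, List.map_cons, List.map_map]
  have e4 : (MulAut.conj (cs.simple i) : W → W) (cs.simple j) = cs.simple j := by simp [e1]
  have e5 : (MulAut.conj (cs.simple j) : W → W) (cs.simple i) = cs.simple i := by simp [e2]
  rw [e4, e5]
  have e6 : ((MulAut.conj (cs.simple j) : W → W) ∘ (MulAut.conj (cs.simple i) : W → W)) =
      ((MulAut.conj (cs.simple i) : W → W) ∘ (MulAut.conj (cs.simple j) : W → W)) := by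
    funext x; simpa using e3 x
  rw [e6]
  apply hx_le_swap
  rw [← map_mul, ← map_mul, hij]

theorem hx_move_symm {B W : Type*} [Group W] {M : CoxeterMatrix B}
    (cs : CoxeterSystem M W) {ω ω' : List B} (h : CommMove cs ω ω') : CommMove cs ω' ω := by
  obtain ⟨l, r, i, j, hij, rfl, rfl⟩ := h
  exact ⟨l, r, j, i, hij.symm, rfl, rfl⟩

theorem hx_moves_symm {B W : Type*} [Group W] {M : CoxeterMatrix B}
    (cs : CoxeterSystem M W) {ω ω' : List B} (h : Relation.ReflTransGen (CommMove cs) ω ω') :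
    Relation.ReflTransGen (CommMove cs) ω' ω := by
  induction h with
  | refl => exact .refl
  | tail _ h ih => exact .head (hx_move_symm cs h) ih

theorem hx_moves_le {B W : Type*} [Group W] {M : CoxeterMatrix B}
    (cs : CoxeterSystem M W) {ω ω' : List B} (h : Relation.ReflTransGen (CommMove cs) ω ω') :
    HxLe (cs.leftInvSeq ω) (cs.leftInvSeq ω') := by
  induction h with
  | refl => exact fun a b _ h => h
  | tail _ h ih => exact fun a b hab hs => hx_move_le cs h a b hab (ih a b hab hs)

theorem hx_moves_inv {B W : Type*} [Group W] {M : CoxeterMatrix B}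
    (cs : CoxeterSystem M W) {ω ω' : List B} (h : Relation.ReflTransGen (CommMove cs) ω ω') :
    ω'.length = ω.length ∧ cs.wordProd ω' = cs.wordProd ω := by
  induction h with
  | refl => exact ⟨rfl, rfl⟩
  | tail _ h ih =>
    obtain ⟨l, r, i, j, hij, rfl, rfl⟩ := h
    rw [← ih.1, ← ih.2]
    refine ⟨by simp, ?_⟩
    simp only [cs.wordProd_append, cs.wordProd_cons]
    rw [← mul_assoc (cs.simple j), ← hij, mul_assoc]

theorem hx_moves_cons {B W : Type*} [Group W] {M : CoxeterMatrix B}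
    (cs : CoxeterSystem M W) (i : B) {ω ω' : List B}
    (h : Relation.ReflTransGen (CommMove cs) ω ω') :
    Relation.ReflTransGen (CommMove cs) (i :: ω) (i :: ω') := by
  refine Relation.ReflTransGen.lift (i :: ·) ?_ _ _ h
  rintro _ _ ⟨l, r, a, b, hab, rfl, rfl⟩
  exact ⟨i :: l, r, a, b, hab, rfl, rfl⟩

theorem hx_to_front {B W : Type*} [Group W] {M : CoxeterMatrix B}
    (cs : CoxeterSystem M W) (j : B) (l : List B) : ∀ (r : List B) (t : W),
    t = cs.wordProd l * cs.simple j * (cs.wordProd l)⁻¹ →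
    (∀ a ∈ cs.leftInvSeq l, a * t = t * a) →
    t = cs.simple j ∧ Relation.ReflTransGen (CommMove cs) (l ++ j :: r) (j :: (l ++ r)) := by
  induction l using List.reverseRecOn with
  | nil => intro r t ht _; exact ⟨by simpa using ht, .refl⟩
  | append_singleton l k ih =>
    intro r t ht hc
    have hk : cs.simple k * cs.simple j = cs.simple j * cs.simple k := by
      have := hc (cs.wordProd l * cs.simple k * (cs.wordProd l)⁻¹)
        (by rw [hx_lis_append]; simp)
      rw [ht, cs.wordProd_append, cs.wordProd_singleton] at this
      have h2 := congrArg (fun x => (cs.wordProd l)⁻¹ * x * cs.wordProd l) this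
      simpa [mul_assoc] using h2.symm
    obtain ⟨h1, h2⟩ := ih (k :: r) t (by
      rw [ht, cs.wordProd_append, cs.wordProd_singleton, mul_assoc (cs.wordProd l), hk]
      simp [mul_assoc]) (fun a ha => hc a (by rw [hx_lis_append]; simp [ha]))
    refine ⟨h1, ?_⟩
    have hm : CommMove cs (l ++ [k] ++ j :: r) (l ++ j :: k :: r) :=
      ⟨l, r, k, j, hk, by simp, rfl⟩
    have := Relation.ReflTransGen.head hm h2
    simpa using this

theorem hx_main {B W : Type*} [Group W] {M : CoxeterMatrix B}
    (cs : CoxeterSystem M W) (ω : List B) : ∀ ω' : List B, cs.IsReduced ω → cs.IsReduced ω' →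
    cs.wordProd ω = cs.wordProd ω' → HxLe (cs.leftInvSeq ω) (cs.leftInvSeq ω') →
    Relation.ReflTransGen (CommMove cs) ω ω' := by
  induction ω with
  | nil =>
    intro ω' h h' hp _
    have : ω'.length = 0 := by rw [← h'.eq, ← hp, h.eq]; rfl
    rw [List.length_eq_zero_iff.1 this]
  | cons i ρ ih =>
    intro ω' h h' hp hle
    have hmem : cs.simple i ∈ cs.leftInvSeq ω' :=
      hx_mem cs h hp (by rw [CoxeterSystem.leftInvSeq]; simp)
    obtain ⟨k, hk, hk2⟩ := List.getElem_of_mem hmem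
    have hk' : k < ω'.length := by simpa using hk
    obtain ⟨l, j, r, rfl, rfl⟩ : ∃ l j r, ω' = l ++ j :: r ∧ l.length = k :=
      ⟨ω'.take k, ω'[k], ω'.drop (k + 1), by simp, by simp; omega⟩
    have hL : cs.leftInvSeq (l ++ j :: r) = cs.leftInvSeq l ++ cs.simple i ::
        ((cs.leftInvSeq (j :: r)).map (MulAut.conj (cs.wordProd l))).tail ∧
        cs.simple i = cs.wordProd l * cs.simple j * (cs.wordProd l)⁻¹ := by
      have hx := hx_lis_append cs l (j :: r)
      have : cs.simple i = cs.wordProd l * cs.simple j * (cs.wordProd l)⁻¹ := by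
        rw [← hk2]
        simp [hx, CoxeterSystem.leftInvSeq, List.getElem_append_right]
      refine ⟨?_, this⟩
      rw [hx, this]; simp [CoxeterSystem.leftInvSeq]
    obtain ⟨hL, hti⟩ := hL
    have hnd := h'.nodup_leftInvSeq
    have hcomm : ∀ a ∈ cs.leftInvSeq l, a * cs.simple i = cs.simple i * a := by
      intro a ha
      by_contra hc
      have ha' : a ∈ cs.leftInvSeq (i :: ρ) := hx_mem cs h' hp.symm (by rw [hL]; simp [ha])
      have hs : [cs.simple i, a].Sublist (cs.leftInvSeq (i :: ρ)) := by
        rw [CoxeterSystem.leftInvSeq] at ha' ⊢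
        apply List.Sublist.cons_cons
        rw [List.singleton_sublist]
        rcases List.mem_cons.1 ha' with rfl | ha'
        · exact absurd rfl hc
        · exact ha'
      have hs2 := hle _ _ (fun e => hc e.symm) hs
      have hs3 : ([a, cs.simple i]).Sublist (cs.leftInvSeq (l ++ j :: r)) := by
        rw [hL]
        exact (List.singleton_sublist.2 ha).append
          (List.singleton_sublist.2 (List.mem_cons_self) : [cs.simple i].Sublist _)
      have hp1 : ([cs.simple i, a]).Perm [a, cs.simple i] := List.Perm.swap _ _ _
      have := List.Nodup.perm_iff_eq_of_sublist hnd hs2 hs3 |>.1 hp1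
      simp at this
      rw [this.1] at hc
      exact hc rfl
    obtain ⟨hij, hmv⟩ := hx_to_front cs j l r _ hti hcomm
    obtain rfl := hx_simple_inj cs hij
    obtain ⟨hlen, hprod⟩ := hx_moves_inv cs hmv
    have hred : cs.IsReduced (i :: (l ++ r)) := by
      rw [CoxeterSystem.IsReduced, hprod, hlen]; exact h'
    refine Relation.ReflTransGen.trans ?_ (hx_moves_symm cs hmv)
    apply hx_moves_cons
    apply ih
    · simpa using h.drop 1
    · simpa using hred.drop 1
    · have : cs.wordProd (i :: ρ) = cs.wordProd (i :: (l ++ r)) := by rw [hp, hprod]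
      rw [cs.wordProd_cons, cs.wordProd_cons] at this
      exact mul_left_cancel this
    · intro a b hab hs
      have hs1 : [MulAut.conj (cs.simple i) a, MulAut.conj (cs.simple i) b].Sublist
          ((cs.leftInvSeq ρ).map (MulAut.conj (cs.simple i))) := by
        simpa using hs.map (MulAut.conj (cs.simple i))
      have hab1 : MulAut.conj (cs.simple i) a * MulAut.conj (cs.simple i) b ≠
          MulAut.conj (cs.simple i) b * MulAut.conj (cs.simple i) a := by
        rw [← map_mul, ← map_mul]
        exact fun e => hab ((MulAut.conj (cs.simple i)).injective e)
      have hs2 := hx_moves_le cs hmv _ _ hab1 (hle _ _ hab1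
        (by rw [CoxeterSystem.leftInvSeq]; exact hs1.cons _))
      rw [CoxeterSystem.leftInvSeq, List.sublist_cons_iff] at hs2
      rcases hs2 with hs2 | ⟨r', hr', -⟩
      · have := hs2.map (MulAut.conj (cs.simple i))
        have hid : ((MulAut.conj (cs.simple i) : W → W) ∘ (MulAut.conj (cs.simple i) : W → W))
            = id := by
          funext x; simp [mul_assoc]
        rw [List.map_map, hid, List.map_id] at this
        simpa [mul_assoc] using this
      · exfalso
        have he := (List.cons_eq_cons.1 hr').1
        have hnd1 := h.nodup_leftInvSeq
        rw [CoxeterSystem.leftInvSeq, List.nodup_cons] at hnd1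
        have hm := hs1.subset (List.mem_cons_self)
        rw [he] at hm
        exact hnd1.1 hm

theorem hx_sublist_iff {W : Type*} (L : List W) (a b : W) :
    [a, b].Sublist L ↔ ∃ j k : ℕ, j < k ∧ L[j]? = some a ∧ L[k]? = some b := by
  constructor
  · intro h
    obtain ⟨f, hf⟩ := List.sublist_iff_exists_orderEmbedding_getElem?_eq.1 h
    refine ⟨f 0, f 1, by simp, ?_, ?_⟩
    · rw [← hf]; rfl
    · rw [← hf]; rfl
  · rintro ⟨j, k, hjk, hj, hk⟩
    induction L generalizing j k with
    | nil => simp at hj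
    | cons c L ih =>
      obtain ⟨k, rfl⟩ : ∃ k', k = k' + 1 := ⟨k - 1, by omega⟩
      rw [List.getElem?_cons_succ] at hk
      cases j with
      | zero =>
        simp at hj
        subst hj
        exact (List.singleton_sublist.2 (List.mem_of_getElem? hk)).cons_cons _
      | succ j =>
        rw [List.getElem?_cons_succ] at hj
        exact (ih j k (by omega) hj hk).cons _

theorem hx_heap_eq {B W : Type*} [Group W] {M : CoxeterMatrix B}
    (cs : CoxeterSystem M W) (ω : List B) : heapLt cs ω = Relation.TransGen
      (fun a b => a * b ≠ b * a ∧ [a, b].Sublist (cs.leftInvSeq ω)) := by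
  unfold heapLt
  congr 1
  funext a b
  apply propext
  rw [hx_sublist_iff]
  constructor
  · rintro ⟨j, k, h1, h2, h3, h4⟩; exact ⟨h4, j, k, h1, h2, h3⟩
  · rintro ⟨h4, j, k, h1, h2, h3⟩; exact ⟨j, k, h1, h2, h3, h4⟩

theorem hx_heap_sub {B W : Type*} [Group W] {M : CoxeterMatrix B}
    (cs : CoxeterSystem M W) {ω : List B} (h : cs.IsReduced ω) {a b : W}
    (hab : heapLt cs ω a b) : [a, b].Sublist (cs.leftInvSeq ω) := by
  rw [hx_heap_eq] at hab
  induction hab with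
  | single h => exact h.2
  | tail _ h1 ih =>
    have h2 := h1.2
    rw [hx_sublist_iff] at ih h2 ⊢
    obtain ⟨j, k, h3, h4, h5⟩ := ih
    obtain ⟨j', k', h6, h7, h8⟩ := h2
    obtain ⟨hk, e1⟩ := List.getElem?_eq_some_iff.1 h5
    obtain ⟨hj, e2⟩ := List.getElem?_eq_some_iff.1 h7
    have : k = j' := (h.nodup_leftInvSeq.getElem_inj_iff).1 (e1.trans e2.symm)
    exact ⟨j, k', by omega, h4, h8⟩

/-- Let `(W, S)` be a finite Coxeter system with longest element `w₀`.  Two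
reduced words `ω`, `ω'` for `w₀` have the same heap poset if and only if they
are related by a finite sequence of commutation moves. -/
theorem heap_eq_iff_commutation {B W : Type*} [Group W] {M : CoxeterMatrix B}
    (cs : CoxeterSystem M W) [Finite W]
    (w₀ : W) (hw₀ : ∀ w : W, cs.length w ≤ cs.length w₀)
    (ω ω' : List B)
    (hω : cs.IsReduced ω) (hωp : cs.wordProd ω = w₀)
    (hω' : cs.IsReduced ω') (hω'p : cs.wordProd ω' = w₀) :
    heapLt cs ω = heapLt cs ω' ↔
      Relation.ReflTransGen (CommMove cs) ω ω' := by
  constructor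
  · intro he
    apply hx_main cs ω ω' hω hω' (hωp.trans hω'p.symm)
    intro a b hab hs
    apply hx_heap_sub cs hω'
    rw [← he, hx_heap_eq]
    exact .single ⟨hab, hs⟩
  · intro hm
    rw [hx_heap_eq, hx_heap_eq]
    congr 1
    funext a b
    apply propext
    exact ⟨fun h => ⟨h.1, hx_moves_le cs hm a b h.1 h.2⟩,
      fun h => ⟨h.1, hx_moves_le cs (hx_moves_symm cs hm) a b h.1 h.2⟩⟩
end

section
/- Let (W, S) be a finite Coxeter system, equipped with the right weak order, and let P be a polygon in the weak order. Then there is a maximal dihedral reflection subgroup D of W such that for each of the two maximal chains C of P, the set of labels of the covering relations of C equals the set of reflections of W contained in D. Moreover, P is a square if and only if D contains exactly two reflections and these two reflections commute. -/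
namespace PolyAux

open Classical in
noncomputable def fgen {B W : Type*} [Group W] {M : CoxeterMatrix B} (cs : CoxeterSystem M W)
    (i : B) : Function.End (W × ZMod 2) :=
  fun p => (cs.simple i * p.1 * cs.simple i, p.2 + if p.1 = cs.simple i then 1 else 0)

section
variable {G : Type*} [Group G]

lemma inv_pow_of_invol {a b : G} (ha : a * a = 1) (hb : b * b = 1) (n : ℕ) :
    ((a * b) ^ n)⁻¹ = (b * a) ^ n := by
  rw [← inv_pow, mul_inv_rev, inv_eq_of_mul_eq_one_left ha, inv_eq_of_mul_eq_one_left hb]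

lemma mul_alt (a b : G) (n : ℕ) : b * (a * b) ^ n = (b * a) ^ n * b := by
  induction n with
  | zero => simp
  | succ n ih => rw [pow_succ, ← mul_assoc, ih, pow_succ]; simp only [mul_assoc]

lemma conj_iff1 {a b : G} (ha : a * a = 1) (hb : b * b = 1) (n : ℕ) (g : G) :
    (a * b) ^ n * g * ((a * b) ^ n)⁻¹ = b ↔ g = (b * a) ^ (2 * n) * b := by
  rw [mul_inv_eq_iff_eq_mul, mul_alt, ← eq_inv_mul_iff_mul_eq, inv_pow_of_invol ha hb,
    ← mul_assoc, ← pow_add, two_mul]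

lemma conj_iff2 {a b : G} (ha : a * a = 1) (hb : b * b = 1) (n : ℕ) (g : G) :
    b * ((a * b) ^ n * g * ((a * b) ^ n)⁻¹) * b = a ↔ g = (b * a) ^ (2 * n + 1) * b := by
  have hb' : b⁻¹ = b := inv_eq_of_mul_eq_one_left hb
  have : b * ((a * b) ^ n * g * ((a * b) ^ n)⁻¹) * b = a ↔
      (a * b) ^ n * g * ((a * b) ^ n)⁻¹ = b * a * b := by
    constructor
    · intro h
      have : ∀ z : G, z = b * (b * z * b) * b := fun z => by
        rw [mul_assoc b z b, ← mul_assoc b b, hb, one_mul, mul_assoc, hb, mul_one]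
      rw [this ((a * b) ^ n * g * ((a * b) ^ n)⁻¹), h]
    · intro h; rw [h]
      rw [mul_assoc b a b, ← mul_assoc b b, hb, one_mul, mul_assoc, hb, mul_one]
  rw [this, mul_inv_eq_iff_eq_mul, mul_assoc (b * a), mul_alt, ← eq_inv_mul_iff_mul_eq,
    inv_pow_of_invol ha hb, ← mul_assoc, ← mul_assoc, ← pow_succ, ← pow_add]
  ring_nf

end

section
variable {B W : Type*} [Group W] {M : CoxeterMatrix B} (cs : CoxeterSystem M W)

open Classical in
lemma fgen_pow (i j : B) (n : ℕ) (g : W) (e : ZMod 2) :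
    ((fgen cs i * fgen cs j) ^ n) (g, e) =
      ((cs.simple i * cs.simple j) ^ n * g * ((cs.simple i * cs.simple j) ^ n)⁻¹,
        e + ∑ k ∈ Finset.range (2 * n),
          if g = (cs.simple j * cs.simple i) ^ k * cs.simple j then 1 else 0) := by
  have ha := cs.simple_mul_simple_self i
  have hb := cs.simple_mul_simple_self j
  induction n with
  | zero => simp; rfl
  | succ n ih =>
    rw [pow_succ']
    change fgen cs i (fgen cs j (((fgen cs i * fgen cs j) ^ n) (g, e))) = _
    rw [ih]
    simp only [fgen]
    ext
    · simp only [pow_succ' (cs.simple i * cs.simple j), mul_inv_rev, cs.inv_simple, mul_assoc]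
    · simp only
      rw [show 2 * (n + 1) = 2 * n + 1 + 1 by ring, Finset.sum_range_succ, Finset.sum_range_succ]
      simp only [conj_iff1 ha hb, conj_iff2 ha hb, add_assoc]

lemma fgen_liftable : M.IsLiftable (fgen cs) := by
  classical
  intro i j
  funext ⟨g, e⟩
  rw [fgen_pow, cs.simple_mul_simple_pow, two_mul, Finset.sum_range_add]
  have : ∀ k, (cs.simple j * cs.simple i) ^ (M i j + k) = (cs.simple j * cs.simple i) ^ k := by
    intro k; rw [pow_add, cs.simple_mul_simple_pow', one_mul]
  simp only [this, CharTwo.add_self_eq_zero]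
  simp; rfl

noncomputable def F : W →* Function.End (W × ZMod 2) := cs.lift ⟨fgen cs, fgen_liftable cs⟩

lemma F_simple (i : B) : F cs (cs.simple i) = fgen cs i := cs.lift_apply_simple _ _

/-- the parity cocycle -/
noncomputable def eta (w t : W) : ZMod 2 := (F cs w⁻¹ (t, 0)).2

lemma F_apply (w g : W) (e : ZMod 2) : F cs w (g, e) = (w * g * w⁻¹, e + eta cs w⁻¹ g) := by
  simp only [eta, inv_inv]
  induction w using cs.simple_induction_left generalizing g e with
  | one => simp; change (g, e) = (g, e + 0); simp
  | mul_simple_left w i ih =>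
    rw [map_mul]
    change F cs _ (F cs w (g, e)) = (_, _ + (F cs _ (F cs w (g, 0))).2)
    rw [ih, ih g 0, F_simple]
    simp [fgen, mul_assoc, add_assoc]

lemma eta_mul (u v t : W) : eta cs (u * v) t = eta cs u t + eta cs v (u⁻¹ * t * u) := by
  have h : F cs (u * v)⁻¹ (t, 0) = F cs v⁻¹ (F cs u⁻¹ (t, 0)) := by
    rw [mul_inv_rev, map_mul]; rfl
  rw [F_apply cs u⁻¹, F_apply cs v⁻¹, F_apply cs (u * v)⁻¹] at h
  have := congrArg Prod.snd h
  simpa using this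

open Classical in
lemma eta_simple (i : B) (t : W) : eta cs (cs.simple i) t = if t = cs.simple i then 1 else 0 := by
  simp [eta, F_simple, fgen]

lemma eta_one (t : W) : eta cs 1 t = 0 := by simp [eta]; rfl

lemma eta_inv (w t : W) : eta cs w⁻¹ t = eta cs w (w * t * w⁻¹) := by
  have := eta_mul cs w⁻¹ w t
  rw [inv_mul_cancel, eta_one, inv_inv] at this
  exact CharTwo.add_eq_zero.mp this.symm

lemma eta_refl {t : W} (ht : cs.IsReflection t) : eta cs t t = 1 := by
  obtain ⟨w, i, rfl⟩ := ht
  rw [eta_mul, eta_mul, eta_inv, eta_simple]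
  have h : w⁻¹ * (w * cs.simple i * w⁻¹) * w = cs.simple i := by group
  rw [h, if_pos rfl]
  have h2 : w * ((w * cs.simple i)⁻¹ * (w * cs.simple i * w⁻¹) * (w * cs.simple i)) * w⁻¹ =
    w * cs.simple i * w⁻¹ := by group
  rw [h2, add_right_comm, CharTwo.add_self_eq_zero, zero_add]

open Classical in
lemma eta_word (ω : List B) (t : W) : eta cs (cs.wordProd ω) t = ((cs.leftInvSeq ω).count t : ℕ) := by
  induction ω generalizing t with
  | nil => simp [eta_one]
  | cons i ω ih =>
    rw [cs.wordProd_cons, eta_mul, ih, eta_simple, CoxeterSystem.leftInvSeq, List.count_cons]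
    have : List.count t (List.map (MulAut.conj (cs.simple i)) (cs.leftInvSeq ω)) =
        List.count ((cs.simple i)⁻¹ * t * cs.simple i) (cs.leftInvSeq ω) := by
      rw [← List.count_map_of_injective (cs.leftInvSeq ω) (MulAut.conj (cs.simple i))
        (MulEquiv.injective _)]
      congr 1
      simp [mul_assoc]
    rw [this, add_comm]
    push_cast
    congr 1
    by_cases h : t = cs.simple i
    · simp [h]
    · simp [h, Ne.symm h]

lemma zmod2 (a : ZMod 2) : a = 0 ∨ a = 1 := by revert a; decide

lemma eta_reduced {ω : List B} (h : cs.IsReduced ω) (t : W) :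
    eta cs (cs.wordProd ω) t = 1 ↔ t ∈ cs.leftInvSeq ω := by
  classical
  rw [eta_word]
  by_cases ht : t ∈ cs.leftInvSeq ω
  · rw [List.count_eq_one_of_mem h.nodup_leftInvSeq ht]; simp [ht]
  · rw [List.count_eq_zero_of_not_mem ht]; simp [ht]

/-- inversion set -/
def N (w : W) : Set W := {t | eta cs w t = 1}

lemma eta_isLeftInversion {w t : W} (h : eta cs w t = 1) : cs.IsLeftInversion w t := by
  obtain ⟨ω, hω, rfl⟩ := cs.exists_isReduced w
  exact cs.isLeftInversion_of_mem_leftInvSeq hω ((eta_reduced cs hω t).1 h)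

lemma eta_iff {w t : W} : eta cs w t = 1 ↔ cs.IsLeftInversion w t := by
  refine ⟨eta_isLeftInversion cs, fun h => ?_⟩
  by_contra h0
  have h0 := (zmod2 _).resolve_right h0
  have h1 : eta cs (t * w) t = 1 := by
    rw [eta_mul, eta_refl cs h.1]
    simp [h0]
  have := (eta_isLeftInversion cs h1).2
  rw [← mul_assoc, h.1.mul_self, one_mul] at this
  exact absurd h.2 (by omega)

lemma ncard_N (w : W) : (N cs w).ncard = cs.length w := by
  classical
  obtain ⟨ω, hω, rfl⟩ := cs.exists_isReduced w
  have : N cs (cs.wordProd ω) = ((cs.leftInvSeq ω).toFinset : Set W) := by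
    ext t; simp [N, eta_reduced cs hω]
  rw [this, Set.ncard_coe_finset, List.toFinset_card_of_nodup hω.nodup_leftInvSeq, hω.eq]
  simp

lemma finite_N (w : W) : (N cs w).Finite := by
  classical
  obtain ⟨ω, hω, rfl⟩ := cs.exists_isReduced w
  have : N cs (cs.wordProd ω) = ((cs.leftInvSeq ω).toFinset : Set W) := by
    ext t; simp [N, eta_reduced cs hω]
  rw [this]; exact Finset.finite_toSet _

end
end PolyAux

namespace PolyAux
section
variable {B W : Type*} [Group W] {M : CoxeterMatrix B} (cs : CoxeterSystem M W)

lemma mem_N_inv_mul (u w t : W) : t ∈ N cs (u⁻¹ * w) ↔ 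
    (u * t * u⁻¹ ∈ N cs u \ N cs w ∨ u * t * u⁻¹ ∈ N cs w \ N cs u) := by
  simp only [N, Set.mem_ofPred_eq, Set.mem_sdiff, eta_mul, eta_inv, inv_inv]
  rcases zmod2 (eta cs u (u * t * u⁻¹)) with h | h <;>
    rcases zmod2 (eta cs w (u * t * u⁻¹)) with h' | h' <;> simp [h, h']

lemma length_inv_mul (u w : W) : cs.length (u⁻¹ * w) =
    (N cs u \ N cs w).ncard + (N cs w \ N cs u).ncard := by
  rw [← ncard_N, ← Set.ncard_union_eq _ ((finite_N cs u).sdiff) ((finite_N cs w).sdiff)]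
  · rw [← Set.ncard_image_of_injective _ (MulAut.conj u).injective]
    congr 1
    ext t
    constructor
    · rintro ⟨z, hz, rfl⟩
      rw [mem_N_inv_mul] at hz
      simpa using hz
    · intro h
      refine ⟨u⁻¹ * t * u, ?_, by simp [mul_assoc]⟩
      rw [mem_N_inv_mul]
      have : u * (u⁻¹ * t * u) * u⁻¹ = t := by group
      rw [this]; exact h
  · rw [Set.disjoint_left]
    rintro t ⟨h1, h2⟩ ⟨h3, h4⟩
    exact h2 h3

lemma weakLE_iff {u w : W} : weakLE cs u w ↔ N cs u ⊆ N cs w := by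
  unfold weakLE
  rw [length_inv_mul, ← ncard_N, ← ncard_N, ← Set.sdiff_eq_empty]
  have h1 := Set.ncard_inter_add_ncard_sdiff_eq_ncard (N cs u) (N cs w) (finite_N cs u)
  have h2 := Set.ncard_inter_add_ncard_sdiff_eq_ncard (N cs w) (N cs u) (finite_N cs w)
  rw [Set.inter_comm] at h2
  rw [← Set.ncard_eq_zero ((finite_N cs u).sdiff)]
  omega

lemma N_inj {u w : W} (h : N cs u = N cs w) : u = w := by
  have := length_inv_mul cs u w
  rw [h] at this
  simp only [Set.sdiff_self, Set.ncard_empty, add_zero, cs.length_eq_zero_iff] at this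
  exact inv_mul_eq_one.mp this

lemma wrefl (u : W) : weakLE cs u u := by simp [weakLE_iff]
lemma wtrans {u v w : W} (h : weakLE cs u v) (h' : weakLE cs v w) : weakLE cs u w := by
  rw [weakLE_iff] at *; exact h.trans h'
lemma wanti {u v : W} (h : weakLE cs u v) (h' : weakLE cs v u) : u = v := by
  rw [weakLE_iff] at *; exact N_inj cs (h.antisymm h')

lemma exists_simple {u v : W} (h : weakLE cs u v) (hne : u ≠ v) :
    ∃ i, weakLE cs u (u * cs.simple i) ∧ weakLE cs (u * cs.simple i) v := by
  have h1 : u⁻¹ * v ≠ 1 := fun h => hne (inv_mul_eq_one.mp h)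
  obtain ⟨i, hi⟩ := cs.exists_leftDescent_of_ne_one h1
  refine ⟨i, ?_⟩
  rw [cs.isLeftDescent_iff] at hi
  unfold weakLE at *
  have e : (u * cs.simple i)⁻¹ * v = cs.simple i * (u⁻¹ * v) := by simp [mul_assoc]
  have e2 : u⁻¹ * (u * cs.simple i) = cs.simple i := by simp
  rw [e, e2, cs.length_simple]
  have h2 := cs.length_mul_le u (cs.simple i)
  have h3 := cs.length_mul_le (u * cs.simple i) ((u * cs.simple i)⁻¹ * v)
  rw [mul_inv_cancel_left, e] at h3
  rw [cs.length_simple] at h2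
  omega

lemma simple_ne_one (i : B) : cs.simple i ≠ 1 := by
  intro h
  have := cs.length_simple i
  rw [h, cs.length_one] at this
  omega

lemma cov_simple {u v : W} (h : CovR (weakLE cs) u v) : ∃ i, v = u * cs.simple i := by
  obtain ⟨i, h1, h2⟩ := exists_simple cs h.1 h.2.1
  refine ⟨i, ?_⟩
  rcases h.2.2 _ h1 h2 with h | h
  · exact absurd (mul_eq_left.mp h) (simple_ne_one cs i)
  · exact h.symm

lemma cov_N {u v : W} (h : CovR (weakLE cs) u v) (t : W) :
    (t ∈ N cs v ∧ t ∉ N cs u) ↔ t = v * u⁻¹ := by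
  obtain ⟨i, rfl⟩ := cov_simple cs h
  have hs := (weakLE_iff cs).1 h.1
  have key : ∀ t, eta cs (u * cs.simple i) t = eta cs u t + eta cs (cs.simple i) (u⁻¹ * t * u) :=
    fun t => eta_mul cs _ _ _
  have e : ∀ t, u⁻¹ * t * u = cs.simple i ↔ t = u * cs.simple i * u⁻¹ := by
    intro t
    constructor
    · intro h; rw [← h]; group
    · rintro rfl; group
  change (eta cs _ t = 1 ∧ ¬ eta cs u t = 1) ↔ _
  have k := key t
  rw [eta_simple] at k
  by_cases h3 : t = u * cs.simple i * u⁻¹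
  · rw [if_pos ((e t).2 h3)] at k
    have h2 : eta cs u t ≠ 1 := by
      intro h4
      have h5 : eta cs (u * cs.simple i) t = 1 := hs h4
      rw [k, h4] at h5
      revert h5; decide
    refine ⟨fun _ => h3, fun _ => ⟨?_, h2⟩⟩
    rw [k, (zmod2 _).resolve_right h2, zero_add]
  · rw [if_neg (fun h => h3 ((e t).1 h)), add_zero] at k
    rw [k]
    exact ⟨fun h => absurd h.1 h.2, fun h => absurd h h3⟩

lemma chainLabels_eq [Finite W] {x y : W} {C : Set W}
    (hC : MaxChainIn (weakLE cs) (IccR (weakLE cs) x y) C) (hx : x ∈ C) (hy : y ∈ C) :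
    chainLabels cs C = N cs y \ N cs x := by
  obtain ⟨hsub, hch, hmax⟩ := hC
  have tot : ∀ a ∈ C, ∀ b ∈ C, weakLE cs a b ∨ weakLE cs b a := by
    intro a ha b hb
    by_cases h : a = b
    · subst h; exact Or.inl (wrefl cs a)
    · exact hch ha hb h
  ext t
  constructor
  · rintro ⟨u, w, hu, hw, hcov, ht⟩
    have := (cov_N cs hcov t).2 ht
    exact ⟨(weakLE_iff cs).1 (hsub hw).2 this.1, fun h => this.2 ((weakLE_iff cs).1 (hsub hu).1 h)⟩
  · rintro ⟨hty, htx⟩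
    obtain ⟨u, ⟨huC, hut⟩, hu⟩ := Set.exists_max_image {c | c ∈ C ∧ t ∉ N cs c} cs.length
      (Set.toFinite _) ⟨x, hx, htx⟩
    obtain ⟨v, ⟨hvC, hvt⟩, hv⟩ := Set.exists_min_image {c | c ∈ C ∧ t ∈ N cs c} cs.length
      (Set.toFinite _) ⟨y, hy, hty⟩
    have eqlen : ∀ a b, weakLE cs a b → cs.length b ≤ cs.length a → a = b := by
      intro a b h1 h2
      unfold weakLE at h1
      exact inv_mul_eq_one.mp (cs.length_eq_zero_iff.mp (by omega))
    have hu' : ∀ c ∈ C, t ∉ N cs c → weakLE cs c u := by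
      intro c hc htc
      rcases tot c hc u huC with h | h
      · exact h
      · rw [eqlen _ _ h (hu c ⟨hc, htc⟩)]; exact wrefl cs c
    have hv' : ∀ c ∈ C, t ∈ N cs c → weakLE cs v c := by
      intro c hc htc
      rcases tot v hvC c hc with h | h
      · exact h
      · rw [eqlen _ _ h (hv c ⟨hc, htc⟩)]; exact wrefl cs v
    have huv : weakLE cs u v := by
      rcases tot u huC v hvC with h | h
      · exact h
      · exact absurd ((weakLE_iff cs).1 h hvt) hut
    have hcov : CovR (weakLE cs) u v := by
      refine ⟨huv, fun h => hut (h ▸ hvt), fun z h1 h2 => ?_⟩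
      have hz : z ∈ C := by
        rw [hmax (insert z C) ?_ ?_ (Set.subset_insert _ _)]
        · exact Set.mem_insert _ _
        · exact Set.insert_subset ⟨wtrans cs (hsub huC).1 h1, wtrans cs h2 (hsub hvC).2⟩ hsub
        · refine hch.insert fun c hc _ => ?_
          by_cases htc : t ∈ N cs c
          · exact Or.inl (wtrans cs h2 (hv' c hc htc))
          · exact Or.inr (wtrans cs (hu' c hc htc) h1)
      by_cases htz : t ∈ N cs z
      · exact Or.inr (wanti cs h2 (hv' z hz htz))
      · exact Or.inl (wanti cs (hu' z hz htz) h1)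
    exact ⟨u, v, huC, hvC, hcov, (cov_N cs hcov t).1 ⟨hvt, hut⟩⟩

lemma extend [Finite W] {x y : W} {K : Set W} (hK : K ⊆ IccR (weakLE cs) x y)
    (hc : IsChain (weakLE cs) K) : ∃ C, MaxChainIn (weakLE cs) (IccR (weakLE cs) x y) C ∧ K ⊆ C := by
  obtain ⟨C, hKC, hC⟩ := (Set.toFinite {K : Set W | K ⊆ IccR (weakLE cs) x y ∧
    IsChain (weakLE cs) K}).exists_le_maximal ⟨hK, hc⟩
  exact ⟨C, ⟨hC.prop.1, hC.prop.2, fun C' h1 h2 h3 => hC.eq_of_le ⟨h1, h2⟩ h3⟩, hKC⟩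

lemma pair_in [Finite W] {x y : W} {C₁ C₂ : Set W} (hP : IsPolygonPair (weakLE cs) x y C₁ C₂)
    {u v : W} (hu : u ∈ IccR (weakLE cs) x y) (hv : v ∈ IccR (weakLE cs) x y)
    (h : weakLE cs u v) : (u ∈ C₁ ∧ v ∈ C₁) ∨ (u ∈ C₂ ∧ v ∈ C₂) := by
  obtain ⟨C, hC, hKC⟩ := extend cs (K := {u, v}) (x := x) (y := y)
    (by rintro z (rfl | rfl) <;> assumption)
    (by
      have : IsChain (weakLE cs) {v} := Set.Subsingleton.isChain Set.subsingleton_singleton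
      exact this.insert (fun b hb _ => by rw [Set.mem_singleton_iff.1 hb]; exact Or.inl h))
  have h1 : u ∈ C := hKC (by simp)
  have h2 : v ∈ C := hKC (by simp)
  rcases hP.2.2.2.2.2.2 C hC with rfl | rfl
  · exact Or.inl ⟨h1, h2⟩
  · exact Or.inr ⟨h1, h2⟩

/-- coset decomposition -/
lemma exists_parabolic_part (J : Subgroup W) (hJ : ∀ u ∈ J, N cs u ⊆ J) (w : W) :
    ∃ u ∈ J, N cs u = N cs w ∩ J := by
  classical
  obtain ⟨v, ⟨u, hu, hv⟩, hmin⟩ : ∃ v, (∃ u ∈ J, w = u * v) ∧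
      ∀ v', (∃ u ∈ J, w = u * v') → cs.length v ≤ cs.length v' := by
    have hne : {v | ∃ u ∈ J, w = u * v}.Nonempty := ⟨w, 1, J.one_mem, by simp⟩
    exact ⟨Function.argminOn cs.length _ hne, Function.argminOn_mem cs.length _ hne,
      fun v' hv' => Function.argminOn_le cs.length _ hv'⟩
  have hdis : ∀ t ∈ J, eta cs v t = 0 := by
    intro t ht
    refine (zmod2 _).resolve_right fun h => ?_
    have hinv := eta_isLeftInversion cs h
    have := hmin (t * v) ⟨u * t⁻¹, J.mul_mem hu (J.inv_mem ht), by rw [hv]; group⟩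
    exact absurd hinv.2 (by omega)
  refine ⟨u, hu, ?_⟩
  ext t
  constructor
  · intro ht
    have htJ := hJ u hu ht
    refine ⟨?_, htJ⟩
    simp only [N, Set.mem_ofPred_eq] at ht ⊢
    rw [hv, eta_mul, hdis _ (J.mul_mem (J.mul_mem (J.inv_mem hu) htJ) hu), ht, add_zero]
  · rintro ⟨ht, htJ⟩
    simp only [N, Set.mem_ofPred_eq] at ht ⊢
    rwa [hv, eta_mul, hdis _ (J.mul_mem (J.mul_mem (J.inv_mem hu) htJ) hu), add_zero] at ht

lemma N_subset_closure (i j : B) : ∀ u ∈ Subgroup.closure {cs.simple i, cs.simple j},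
    N cs u ⊆ Subgroup.closure {cs.simple i, cs.simple j} := by
  intro u hu
  set J := Subgroup.closure {cs.simple i, cs.simple j} with hJdef
  have : u ∈ J ∧ ∀ t, eta cs u t = 1 → t ∈ J := by
    induction hu using Subgroup.closure_induction with
    | mem x hx =>
      refine ⟨Subgroup.subset_closure hx, fun t ht => ?_⟩
      have : t = x := by
        rcases hx with rfl | rfl <;>
        · rw [eta_simple] at ht
          by_contra h; simp [h] at ht
      rw [this]; exact Subgroup.subset_closure hx
    | one => exact ⟨J.one_mem, fun t ht => by simp [eta_one] at ht⟩
    | mul u v _ _ hu hv =>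
      refine ⟨J.mul_mem hu.1 hv.1, fun t ht => ?_⟩
      rw [eta_mul] at ht
      rcases zmod2 (eta cs u t) with h | h
      · rw [h, zero_add] at ht
        have := J.mul_mem (J.mul_mem hu.1 (hv.2 _ ht)) (J.inv_mem hu.1)
        have e : u * (u⁻¹ * t * u) * u⁻¹ = t := by group
        rwa [e] at this
      · exact hu.2 t h
    | inv u _ hu =>
      refine ⟨J.inv_mem hu.1, fun t ht => ?_⟩
      rw [eta_inv] at ht
      have := J.mul_mem (J.mul_mem (J.inv_mem hu.1) (hu.2 _ ht)) hu.1
      have e : u⁻¹ * (u * t * u⁻¹) * u = t := by group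
      rwa [e] at this
  exact this.2

end
end PolyAux

namespace PolyAux
section
variable {G : Type*} [Group G]

lemma invol_conj_zpow {a b : G} (ha : a * a = 1) (hb : b * b = 1) (n : ℤ) :
    a * (a * b) ^ n = (a * b) ^ (-n) * a := by
  have h1 : SemiconjBy a (a * b) (a * b)⁻¹ := by
    rw [SemiconjBy, mul_inv_rev, inv_eq_of_mul_eq_one_left ha, inv_eq_of_mul_eq_one_left hb,
      ← mul_assoc, ha, mul_assoc, ha, mul_one, one_mul]
  have := (h1.zpow_right n).eq
  rwa [inv_zpow'] at this

lemma closure_form {a b : G} (ha : a * a = 1) (hb : b * b = 1) {g : G}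
    (hg : g ∈ Subgroup.closure {a, b}) : ∃ n : ℤ, g = (a * b) ^ n ∨ g = (a * b) ^ n * a := by
  have hai : a⁻¹ = a := inv_eq_of_mul_eq_one_left ha
  induction hg using Subgroup.closure_induction with
  | mem x hx =>
    rcases hx with rfl | rfl
    · exact ⟨0, Or.inr (by simp)⟩
    · exact ⟨-1, Or.inr (by
        rw [zpow_neg_one, mul_inv_rev, hai, inv_eq_of_mul_eq_one_left hb, mul_assoc, ha, mul_one])⟩
  | one => exact ⟨0, Or.inl (by simp)⟩
  | mul u v _ _ hu hv =>
    obtain ⟨n, rfl | rfl⟩ := hu <;> obtain ⟨k, rfl | rfl⟩ := hv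
    · exact ⟨n + k, Or.inl (by rw [zpow_add])⟩
    · exact ⟨n + k, Or.inr (by rw [zpow_add, mul_assoc])⟩
    · exact ⟨n - k, Or.inr (by rw [mul_assoc, invol_conj_zpow ha hb, ← mul_assoc, sub_eq_add_neg,
        zpow_add])⟩
    · exact ⟨n - k, Or.inl (by rw [mul_assoc, ← mul_assoc a, invol_conj_zpow ha hb, mul_assoc, ha,
        mul_one, sub_eq_add_neg, zpow_add])⟩
  | inv u _ hu =>
    obtain ⟨n, rfl | rfl⟩ := hu
    · exact ⟨-n, Or.inl (by simp)⟩
    · exact ⟨n, Or.inr (by rw [mul_inv_rev, hai, ← zpow_neg, invol_conj_zpow ha hb, neg_neg])⟩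

lemma zpow_to_pow [Finite G] (g : G) (n : ℤ) : ∃ k < orderOf g, g ^ n = g ^ k := by
  classical
  have : g ^ n ∈ Subgroup.zpowers g := ⟨n, rfl⟩
  rw [(isOfFinOrder_of_finite g).mem_zpowers_iff_mem_range_orderOf] at this
  simp only [Finset.mem_image, Finset.mem_range] at this
  obtain ⟨k, hk, h⟩ := this
  exact ⟨k, hk, h.symm⟩

lemma unique_invol [Finite G] {g x y : G} (hx : x ∈ Subgroup.zpowers g)
    (hy : y ∈ Subgroup.zpowers g) (hx2 : x * x = 1) (hy2 : y * y = 1) (hx1 : x ≠ 1) (hy1 : y ≠ 1) :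
    x = y := by
  have key : ∀ x ∈ Subgroup.zpowers g, x * x = 1 → x ≠ 1 → ∃ k, x = g ^ k ∧ 2 * k = orderOf g := by
    rintro _ ⟨n, rfl⟩ h2 h1
    obtain ⟨k, hk, h⟩ := zpow_to_pow g n
    simp only at h1 h2
    rw [h] at h1 h2
    refine ⟨k, h, ?_⟩
    rw [← pow_add] at h2
    obtain ⟨c, hc⟩ := orderOf_dvd_of_pow_eq_one h2
    have hk0 : k ≠ 0 := by rintro rfl; simp at h1
    have hc2 : c < 2 := by
      by_contra hcc
      have : orderOf g * 2 ≤ orderOf g * c := Nat.mul_le_mul_left _ (by omega)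
      omega
    interval_cases c <;> omega
  obtain ⟨k, rfl, hk⟩ := key x hx hx2 hx1
  obtain ⟨l, rfl, hl⟩ := key y hy hy2 hy1
  congr 1; omega

end

section
variable {B W : Type*} [Group W] {M : CoxeterMatrix B} (cs : CoxeterSystem M W)

lemma parity_refl {t : W} (ht : cs.IsReflection t) : cs.lengthParity t = Multiplicative.ofAdd 1 := by
  obtain ⟨w, i, rfl⟩ := ht
  rw [map_mul, map_mul, map_inv, mul_comm (cs.lengthParity w), mul_inv_cancel_right,
    cs.lengthParity_simple]

lemma refl_form {a b t : W} (ha : cs.IsReflection a) (hb : cs.IsReflection b)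
    (ht : cs.IsReflection t) (h : t ∈ Subgroup.closure {a, b}) : ∃ n : ℤ, t = (a * b) ^ n * a := by
  obtain ⟨n, rfl | h⟩ := closure_form ha.mul_self hb.mul_self h
  · exfalso
    have := parity_refl cs ht
    rw [map_zpow, map_mul, parity_refl cs ha, parity_refl cs hb, ← ofAdd_add] at this
    have e : (1 : ZMod 2) + 1 = 0 := by decide
    rw [e, ofAdd_zero, one_zpow] at this
    revert this; decide
  · exact ⟨n, h⟩

open Classical in
lemma eta_alt (i j : B) (k : ℕ) (t : W) :
    eta cs ((cs.simple i * cs.simple j) ^ k) t = ∑ l ∈ Finset.range (2 * k),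
      (if t = (cs.simple i * cs.simple j) ^ l * cs.simple i then 1 else 0) ∧
    eta cs ((cs.simple i * cs.simple j) ^ k * cs.simple i) t = ∑ l ∈ Finset.range (2 * k + 1),
      (if t = (cs.simple i * cs.simple j) ^ l * cs.simple i then 1 else 0) := by
  have ha := cs.simple_mul_simple_self i
  have hb := cs.simple_mul_simple_self j
  have e1 : ∀ k : ℕ, ((cs.simple i * cs.simple j) ^ k)⁻¹ = (cs.simple j * cs.simple i) ^ k :=
    inv_pow_of_invol ha hb
  have e2 : ∀ k : ℕ, (cs.simple i * cs.simple j) ^ k = ((cs.simple j * cs.simple i) ^ k)⁻¹ :=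
    fun k => (inv_pow_of_invol hb ha k).symm
  have step : ∀ k : ℕ, eta cs ((cs.simple i * cs.simple j) ^ k) t = ∑ l ∈ Finset.range (2 * k),
      (if t = (cs.simple i * cs.simple j) ^ l * cs.simple i then 1 else 0) →
    eta cs ((cs.simple i * cs.simple j) ^ k * cs.simple i) t = ∑ l ∈ Finset.range (2 * k + 1),
      (if t = (cs.simple i * cs.simple j) ^ l * cs.simple i then 1 else 0) := by
    intro k h
    rw [eta_mul, h, Finset.sum_range_succ, eta_simple]
    congr 1
    have := conj_iff1 hb ha k t
    rw [← e1, inv_inv] at this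
    simp only [this]
  induction k with
  | zero => exact ⟨by simp [eta_one], step 0 (by simp [eta_one])⟩
  | succ k ih =>
    have : eta cs ((cs.simple i * cs.simple j) ^ (k + 1)) t = ∑ l ∈ Finset.range (2 * (k + 1)),
      (if t = (cs.simple i * cs.simple j) ^ l * cs.simple i then 1 else 0) := by
      rw [pow_succ, ← mul_assoc, eta_mul, ih.2, show 2 * (k + 1) = 2 * k + 1 + 1 by ring,
        Finset.sum_range_succ _ (2 * k + 1), eta_simple]
      congr 1
      have := conj_iff2 hb ha k t
      rw [← e1, inv_inv] at this
      rw [mul_inv_rev, cs.inv_simple]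
      simp only [mul_assoc] at this ⊢
      simp only [this]
    exact ⟨this, step _ this⟩

lemma sum_mod {m c : ℕ} (hc : c < m) (n : ℕ) (hn : n ≤ 2 * m) :
    ∑ l ∈ Finset.range n, (if l % m = c then (1 : ZMod 2) else 0) =
      (if c < n then 1 else 0) + (if c + m < n then 1 else 0) := by
  induction n with
  | zero => simp
  | succ n ih =>
    rw [Finset.sum_range_succ, ih (by omega)]
    have : n % m = c ↔ n = c ∨ n = c + m := by
      constructor
      · intro h
        have h1 := Nat.div_add_mod n m
        have h2 : n / m < 2 := by rw [Nat.div_lt_iff_lt_mul (by omega)]; omega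
        interval_cases h3 : n / m <;> omega
      · rintro (rfl | rfl)
        · exact Nat.mod_eq_of_lt hc
        · rw [Nat.add_mod_right]; exact Nat.mod_eq_of_lt hc
    simp only [this]
    split_ifs <;> first | omega | simp

lemma N_longest [Finite W] {i j : B} (hij : cs.simple i ≠ cs.simple j) {w : W}
    (hw : w ∈ Subgroup.closure {cs.simple i, cs.simple j}) (hi : cs.simple i ∈ N cs w)
    (hj : cs.simple j ∈ N cs w) :
    N cs w = reflectionsIn cs (Subgroup.closure {cs.simple i, cs.simple j}) := by
  classical
  have ha := cs.simple_mul_simple_self i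
  have hb := cs.simple_mul_simple_self j
  set a := cs.simple i with hadef
  set b := cs.simple j with hbdef
  set m := orderOf (a * b) with hm
  have hm0 : 0 < m := orderOf_pos _
  obtain ⟨n, hn, hη⟩ : ∃ n ≤ 2 * m, ∀ c < m, eta cs w ((a * b) ^ c * a) =
      (if c < n then 1 else 0) + (if c + m < n then 1 else 0) := by
    have red : ∀ (c : ℕ), c < m → ∀ l, ((a * b) ^ c * a = (a * b) ^ l * a ↔ l % m = c) := by
      intro c hc l
      rw [mul_left_inj, pow_inj_mod, ← hm, Nat.mod_eq_of_lt hc, eq_comm]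
    obtain ⟨n, h⟩ := closure_form ha hb hw
    obtain ⟨k, hk, hk'⟩ := zpow_to_pow (a * b) n
    rw [hk'] at h
    rcases h with rfl | rfl
    · refine ⟨2 * k, by omega, fun c hc => ?_⟩
      rw [(eta_alt cs i j k _).1, ← sum_mod hc _ (by omega)]
      exact Finset.sum_congr rfl fun l _ => by simp only [← hadef, ← hbdef, red c hc l]
    · refine ⟨2 * k + 1, by omega, fun c hc => ?_⟩
      rw [(eta_alt cs i j k _).2, ← sum_mod hc _ (by omega)]
      exact Finset.sum_congr rfl fun l _ => by simp only [← hadef, ← hbdef, red c hc l]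
  have hbm : (a * b) ^ (m - 1) * a = b := by
    have h1 : (a * b) ^ (m - 1) * (a * b) = 1 := by
      rw [← pow_succ, Nat.sub_add_cancel hm0, pow_orderOf_eq_one]
    rw [← mul_assoc] at h1
    rw [eq_inv_of_mul_eq_one_left h1, inv_eq_of_mul_eq_one_left hb]
  have h1 := hη 0 hm0
  have h2 := hη (m - 1) (by omega)
  rw [pow_zero, one_mul] at h1
  rw [hbm] at h2
  have hi' : eta cs w a = 1 := hi
  have hj' : eta cs w b = 1 := hj
  rw [hi'] at h1
  rw [hj'] at h2
  have hnm : n = m := by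
    have A : 0 < n ∧ n ≤ m := by
      split_ifs at h1 with u v v
      · exact absurd h1 (by decide)
      · omega
      · omega
      · exact absurd h1 (by decide)
    have B : m - 1 < n := by
      split_ifs at h2 with u v v
      · omega
      · omega
      · omega
      · exact absurd h2 (by decide)
    omega
  ext t
  constructor
  · intro ht
    exact ⟨(eta_isLeftInversion cs ht).1, N_subset_closure cs i j w hw ht⟩
  · rintro ⟨htr, ht⟩
    obtain ⟨n', hn'⟩ := refl_form cs (cs.isReflection_simple i) (cs.isReflection_simple j) htr ht
    obtain ⟨k, hk, hk'⟩ := zpow_to_pow (a * b) n'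
    rw [hk'] at hn'
    change eta cs w t = 1
    rw [hn', hη k hk, hnm, if_pos hk, if_neg (by omega), add_zero]

/-- canonical generators of a reflection subgroup -/
def chi (H : Subgroup W) : Set W :=
  {r | r ∈ H ∧ cs.IsReflection r ∧ ∀ t ∈ H, t ≠ r → eta cs r t = 0}

lemma simple_mem_chi {H : Subgroup W} {i : B} (h : cs.simple i ∈ H) : cs.simple i ∈ chi cs H :=
  ⟨h, cs.isReflection_simple i, fun t _ hne => by rw [eta_simple, if_neg hne]⟩

lemma chi_conj {H : Subgroup W} {i : B} (h : cs.simple i ∉ H) {r : W}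
    (hr : r ∈ chi cs (H.comap (MulAut.conj (cs.simple i)).toMonoidHom)) :
    cs.simple i * r * (cs.simple i)⁻¹ ∈ chi cs H := by
  obtain ⟨h1, h2, h3⟩ := hr
  set s := cs.simple i with hs
  have h1' : s * r * s⁻¹ ∈ H := h1
  refine ⟨h1', h2.conj s, fun t ht hne => ?_⟩
  rw [eta_mul, eta_mul, hs, cs.inv_simple, eta_simple, eta_simple, ← hs, if_neg, if_neg, h3]
  · simp
  · change s * (s * t * s) * s⁻¹ ∈ H
    have : s * (s * t * s) * s⁻¹ = t := by
      rw [mul_assoc s t s, ← mul_assoc s s, hs, cs.simple_mul_simple_self, one_mul, mul_inv_cancel_right]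
    rwa [this]
  · rintro rfl
    apply hne
    have : s * (s * t * s) * s⁻¹ = t := by
      rw [mul_assoc s t s, ← mul_assoc s s, hs, cs.simple_mul_simple_self, one_mul, mul_inv_cancel_right]
    exact this.symm
  · intro h4
    apply h
    have h5 : (s * r * s⁻¹)⁻¹ * t * (s * r * s⁻¹) = s * ((s * r)⁻¹ * t * (s * r)) * s⁻¹ := by group
    rw [h4, mul_inv_cancel_right] at h5
    rw [← h5]
    exact mul_mem (mul_mem (inv_mem h1') ht) h1'
  · rintro rfl; exact h ht

lemma gen_chi (v : W) (i : B) : ∀ H : Subgroup W, v * cs.simple i * v⁻¹ ∈ H →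
    v * cs.simple i * v⁻¹ ∈ Subgroup.closure (chi cs H) := by
  induction v using cs.simple_induction_left with
  | one => 
    intro H h
    simp only [one_mul, inv_one, mul_one] at h ⊢
    exact Subgroup.subset_closure (simple_mem_chi cs h)
  | mul_simple_left v j ih =>
    intro H h
    have e : cs.simple j * v * cs.simple i * (cs.simple j * v)⁻¹ =
      cs.simple j * (v * cs.simple i * v⁻¹) * (cs.simple j)⁻¹ := by group
    rw [e] at h ⊢
    by_cases hj : cs.simple j ∈ H
    · have h1 := Subgroup.subset_closure (simple_mem_chi cs hj)
      refine mul_mem (mul_mem h1 (ih H ?_)) (inv_mem h1)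
      have := H.mul_mem (H.mul_mem (H.inv_mem hj) h) hj
      have e : (cs.simple j)⁻¹ * (cs.simple j * (v * cs.simple i * v⁻¹) * (cs.simple j)⁻¹) *
        cs.simple j = v * cs.simple i * v⁻¹ := by group
      rwa [e] at this
    · have h1 := ih (H.comap (MulAut.conj (cs.simple j)).toMonoidHom) h
      have h2 : Subgroup.closure (chi cs (H.comap (MulAut.conj (cs.simple j)).toMonoidHom)) ≤
          (Subgroup.closure (chi cs H)).comap (MulAut.conj (cs.simple j)).toMonoidHom := by
        rw [Subgroup.closure_le]
        intro r hr
        exact Subgroup.subset_closure (chi_conj cs hj hr)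
      exact h2 h1

lemma no_xyx {H : Subgroup W} {x y z : W} (hx : x ∈ chi cs H) (hy : y ∈ chi cs H)
    (hz : z ∈ chi cs H) (hxy : x ≠ y) (hxz : x ≠ z) (hyz : y ≠ z) : x * y * x ≠ z := by
  intro h
  have h1 := hz.2.2 x hx.1 hxz
  have xx := hx.2.1.mul_self
  have xi := hx.2.1.inv
  have yi := hy.2.1.inv
  rw [← h, eta_mul, eta_mul, eta_refl cs hx.2.1, inv_mul_cancel, one_mul, hy.2.2 x hx.1 hxy,
    mul_inv_rev, hx.2.2] at h1
  · simp at h1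
  · exact mul_mem (mul_mem (mul_mem (inv_mem hy.1) (inv_mem hx.1)) hx.1) (mul_mem hx.1 hy.1)
  · rw [xi, yi, mul_assoc y, xx, mul_one]
    intro h2
    apply hyz
    have yy := hy.2.1.mul_self
    have h3 : x * y = y * x := by
      nth_rw 2 [← h2]
      rw [← mul_assoc, yy, one_mul]
    rw [← h, h3, mul_assoc, xx, mul_one]

lemma chi_three {H : Subgroup W} {a b c : W} (ha : a ∈ chi cs H) (hb : b ∈ chi cs H)
    (hc : c ∈ chi cs H) (hab : a ≠ b) (hac : a ≠ c) (hbc : b ≠ c)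
    (h : a * c = b * c * a * b) : a * b * c * b * a = c := by
  have aa := ha.2.1.mul_self
  have bb := hb.2.1.mul_self
  have cc := hc.2.1.mul_self
  have ai := ha.2.1.inv
  have bi := hb.2.1.inv
  have ci := hc.2.1.inv
  have bcb : b * c * b ∈ H := mul_mem (mul_mem hb.1 hc.1) hb.1
  have h1 : eta cs (a * c) (b * c * b) = eta cs (b * c * a * b) (b * c * b) := by rw [h]
  have e1 : b⁻¹ * (b * c * b) * b = c := by rw [mul_assoc b c b, inv_mul_cancel_left, mul_assoc, bb, mul_one]
  have e2 : (b * c)⁻¹ * (b * c * b) * (b * c) = c := by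
    rw [inv_mul_cancel_left, ← mul_assoc, bb, one_mul]
  have e3 : (b * c * a)⁻¹ * (b * c * b) * (b * c * a) = a * c * a := by
    rw [mul_inv_rev, mul_assoc a⁻¹, mul_assoc a⁻¹, inv_mul_cancel_left, ai, mul_assoc b c a,
      ← mul_assoc b b, bb, one_mul, mul_assoc]
  rw [eta_mul, eta_mul, eta_mul, eta_mul, e1, e2, e3, ha.2.2 _ bcb (no_xyx cs hb hc ha hbc hab.symm hac.symm),
    hb.2.2 _ bcb, eta_refl cs hc.2.1, ha.2.2 c hc.1 hac.symm,
    hb.2.2 (a * c * a) (mul_mem (mul_mem ha.1 hc.1) ha.1) (no_xyx cs ha hc hb hac hab hbc.symm)] at h1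
  · by_contra h2
    rw [hc.2.2] at h1
    · simp at h1
    · exact mul_mem (mul_mem (inv_mem ha.1) bcb) ha.1
    · rw [ai]; simpa only [mul_assoc] using h2
  · intro h2
    rw [mul_assoc, mul_eq_left] at h2
    exact hbc (by rw [← bi]; exact (eq_inv_of_mul_eq_one_left h2).symm)

lemma chi_le_two [Finite W] {t₁ t₂ : W} (h1 : cs.IsReflection t₁) (h2 : cs.IsReflection t₂)
    {a b c : W} (ha : a ∈ chi cs (Subgroup.closure {t₁, t₂}))
    (hb : b ∈ chi cs (Subgroup.closure {t₁, t₂})) (hc : c ∈ chi cs (Subgroup.closure {t₁, t₂}))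
    (hab : a ≠ b) (hac : a ≠ c) (hbc : b ≠ c) : False := by
  have rot : ∀ x ∈ chi cs (Subgroup.closure {t₁, t₂}), ∀ y ∈ chi cs (Subgroup.closure {t₁, t₂}),
      x * y ∈ Subgroup.zpowers (t₁ * t₂) := by
    intro x hx y hy
    obtain ⟨n, rfl⟩ := refl_form cs h1 h2 hx.2.1 hx.1
    obtain ⟨k, rfl⟩ := refl_form cs h1 h2 hy.2.1 hy.1
    refine ⟨n - k, ?_⟩
    simp only
    rw [mul_assoc, ← mul_assoc t₁, invol_conj_zpow h1.mul_self h2.mul_self, mul_assoc, h1.mul_self,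
        mul_one, sub_eq_add_neg, zpow_add]
  have comm : ∀ x y z w, x ∈ chi cs (Subgroup.closure {t₁, t₂}) →
      y ∈ chi cs (Subgroup.closure {t₁, t₂}) → z ∈ chi cs (Subgroup.closure {t₁, t₂}) →
      w ∈ chi cs (Subgroup.closure {t₁, t₂}) → x * y * (z * w) = z * w * (x * y) := by
    intro x y z w hx hy hz hw
    obtain ⟨n, hn⟩ := rot x hx y hy
    obtain ⟨k, hk⟩ := rot z hz w hw
    simp only at hn hk
    rw [← hn, ← hk, ← zpow_add, ← zpow_add, add_comm]
  have key : ∀ a b c, a ∈ chi cs (Subgroup.closure {t₁, t₂}) →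
      b ∈ chi cs (Subgroup.closure {t₁, t₂}) → c ∈ chi cs (Subgroup.closure {t₁, t₂}) →
      a ≠ b → a ≠ c → b ≠ c → a * b = b * a := by
    intro a b c ha hb hc hab hac hbc
    have aa := ha.2.1.mul_self
    have bb := hb.2.1.mul_self
    have cc := hc.2.1.mul_self
    have h3 : a * c = b * c * a * b := by
      have := comm a b b c ha hb hb hc
      rw [mul_assoc a b, ← mul_assoc b b, bb, one_mul] at this
      rw [this, ← mul_assoc]
    have h4 := chi_three cs ha hb hc hab hac hbc h3
    have h5 := comm c a b c hc ha hb hc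
    have h6 : a * b * c = c * a * b := by
      nth_rw 2 [← h4]
      simp only [mul_assoc]
      rw [← mul_assoc a a, aa, one_mul, bb, mul_one]
    have h7 : a * b = c * a * b * c := by
      rw [← h6, mul_assoc, cc, mul_one]
    rw [h7, mul_assoc, h5]
    simp only [mul_assoc]
    rw [← mul_assoc c c, cc, one_mul]
  have k1 := key a b c ha hb hc hab hac hbc
  have k2 := key b c a hb hc ha hbc hab.symm hac.symm
  have aa := ha.2.1.mul_self
  have bb := hb.2.1.mul_self
  have cc := hc.2.1.mul_self
  have u := unique_invol (rot a ha b hb) (rot b hb c hc)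
    (by nth_rw 2 [k1]; rw [mul_assoc, ← mul_assoc b b, bb, one_mul, aa])
    (by nth_rw 2 [k2]; rw [mul_assoc, ← mul_assoc c c, cc, one_mul, bb])
    (fun h => hab (by rw [eq_inv_of_mul_eq_one_left h, hb.2.1.inv]))
    (fun h => hbc (by rw [eq_inv_of_mul_eq_one_left h, hc.2.1.inv]))
  rw [k1] at u
  exact hac (mul_left_cancel u)

lemma max_of_simple [Finite W] {i j : B} (hij : cs.simple i ≠ cs.simple j) {D : Subgroup W}
    (hD : IsDihedralSubgroup cs D) (h : Subgroup.closure {cs.simple i, cs.simple j} ≤ D) :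
    Subgroup.closure {cs.simple i, cs.simple j} = D := by
  obtain ⟨t₁, t₂, h1, h2, rfl⟩ := hD
  have hi : cs.simple i ∈ chi cs (Subgroup.closure {t₁, t₂}) :=
    simple_mem_chi cs (h (Subgroup.subset_closure (by simp)))
  have hj : cs.simple j ∈ chi cs (Subgroup.closure {t₁, t₂}) :=
    simple_mem_chi cs (h (Subgroup.subset_closure (by simp)))
  have hchi : chi cs (Subgroup.closure {t₁, t₂}) ⊆ {cs.simple i, cs.simple j} := by
    intro r hr
    by_contra h3
    simp only [Set.mem_insert_iff, Set.mem_singleton_iff, not_or] at h3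
    exact chi_le_two cs h1 h2 hi hj hr hij (Ne.symm h3.1) (Ne.symm h3.2)
  have hg : ∀ t, cs.IsReflection t → t ∈ Subgroup.closure {t₁, t₂} →
      t ∈ Subgroup.closure {cs.simple i, cs.simple j} := by
    rintro _ ⟨v, k, rfl⟩ ht
    exact Subgroup.closure_mono hchi (gen_chi cs v k _ ht)
  refine le_antisymm h ((Subgroup.closure_le _).2 ?_)
  rintro t (rfl | rfl)
  · exact hg _ h1 (Subgroup.subset_closure (by simp))
  · exact hg _ h2 (Subgroup.subset_closure (by simp))

end
end PolyAux

namespace PolyAux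
section
variable {B W : Type*} [Group W] {M : CoxeterMatrix B} (cs : CoxeterSystem M W)

lemma map_conj_dihedral {D : Subgroup W} (hD : IsDihedralSubgroup cs D) (x : W) :
    IsDihedralSubgroup cs (D.map (MulAut.conj x).toMonoidHom) := by
  obtain ⟨t₁, t₂, h1, h2, rfl⟩ := hD
  refine ⟨x * t₁ * x⁻¹, x * t₂ * x⁻¹, h1.conj x, h2.conj x, ?_⟩
  rw [MonoidHom.map_closure, Set.image_pair]
  rfl

lemma mem_map_conj {D : Subgroup W} {x t : W} :
    t ∈ D.map (MulAut.conj x).toMonoidHom ↔ x⁻¹ * t * x ∈ D := by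
  constructor
  · rintro ⟨z, hz, rfl⟩
    have : x⁻¹ * (x * z * x⁻¹) * x = z := by group
    change x⁻¹ * (x * z * x⁻¹) * x ∈ D
    rwa [this]
  · intro h
    refine ⟨_, h, ?_⟩
    change x * (x⁻¹ * t * x) * x⁻¹ = t
    group

lemma max_conj [Finite W] {i j : B} (hij : cs.simple i ≠ cs.simple j) (x : W) :
    IsMaxDihedralSubgroup cs
      ((Subgroup.closure {cs.simple i, cs.simple j}).map (MulAut.conj x).toMonoidHom) := by
  have hJ : IsDihedralSubgroup cs (Subgroup.closure {cs.simple i, cs.simple j}) :=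
    ⟨_, _, cs.isReflection_simple i, cs.isReflection_simple j, rfl⟩
  refine ⟨map_conj_dihedral cs hJ x, fun D' hD' hle => ?_⟩
  have := max_of_simple cs hij (map_conj_dihedral cs hD' x⁻¹) (by
    intro t ht
    rw [mem_map_conj]
    apply hle
    rw [mem_map_conj]
    have : x⁻¹ * (x⁻¹⁻¹ * t * x⁻¹) * x = t := by group
    rwa [this])
  ext t
  rw [this, mem_map_conj, mem_map_conj]
  have : x⁻¹⁻¹ * (x⁻¹ * t * x) * x⁻¹ = t := by group
  rw [this]

/-- structure of polygons -/
lemma polygon_struct [Finite W] {x y : W} {C₁ C₂ : Set W}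
    (hP : IsPolygonPair (weakLE cs) x y C₁ C₂) :
    ∃ i j, cs.simple i ≠ cs.simple j ∧
      x⁻¹ * y ∈ Subgroup.closure {cs.simple i, cs.simple j} ∧
      cs.simple i ∈ N cs (x⁻¹ * y) ∧ cs.simple j ∈ N cs (x⁻¹ * y) := by
  have hxy := hP.1
  have hunion := hP.2.2.2.2.1
  have hint := hP.2.2.2.2.2.1
  have hne := hP.2.2.2.1
  have hC1 := hP.2.1
  have hC2 := hP.2.2.1
  have hx1 : x ∈ C₁ ∩ C₂ := by rw [hint]; simp
  have hy1 : y ∈ C₁ ∩ C₂ := by rw [hint]; simp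
  have inter : ∀ z, z ∈ C₁ → z ∈ C₂ → z = x ∨ z = y := by
    intro z h1 h2
    have : z ∈ C₁ ∩ C₂ := ⟨h1, h2⟩
    rw [hint] at this
    simpa using this
  obtain ⟨c₁, hc1, hc1'⟩ : ∃ c ∈ C₁, c ∉ C₂ := by
    by_contra h
    push Not at h
    exact hne (hC1.2.2 C₂ hC2.1 hC2.2.1 h)
  obtain ⟨c₂, hc2, hc2'⟩ : ∃ c ∈ C₂, c ∉ C₁ := by
    by_contra h
    push Not at h
    exact hne (hC2.2.2 C₁ hC1.1 hC1.2.1 h).symm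
  have hc1x : x ≠ c₁ := fun h => hc1' (h ▸ hx1.2)
  have hc2x : x ≠ c₂ := fun h => hc2' (h ▸ hx1.1)
  have hc1y : c₁ ≠ y := fun h => hc1' (h ▸ hy1.2)
  have hc2y : c₂ ≠ y := fun h => hc2' (h ▸ hy1.1)
  have i1 := hC1.1 hc1
  have i2 := hC2.1 hc2
  obtain ⟨i, hi1, hi2⟩ := exists_simple cs i1.1 hc1x
  obtain ⟨j, hj1, hj2⟩ := exists_simple cs i2.1 hc2x
  have ii : x * cs.simple i ∈ IccR (weakLE cs) x y := ⟨hi1, wtrans cs hi2 i1.2⟩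
  have jj : x * cs.simple j ∈ IccR (weakLE cs) x y := ⟨hj1, wtrans cs hj2 i2.2⟩
  have xne : ∀ k, x * cs.simple k ≠ x := fun k h => simple_ne_one cs k (mul_eq_left.mp h)
  have mi : x * cs.simple i ∈ C₁ :=
    ((pair_in cs hP ii i1 hi2).resolve_right (fun h => hc1' h.2)).1
  have mj : x * cs.simple j ∈ C₂ :=
    ((pair_in cs hP jj i2 hj2).resolve_left (fun h => hc2' h.2)).1
  have yi : x * cs.simple i ≠ y := fun h => hc1y (wanti cs i1.2 (h ▸ hi2))
  have yj : x * cs.simple j ≠ y := fun h => hc2y (wanti cs i2.2 (h ▸ hj2))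
  have mi' : x * cs.simple i ∉ C₂ := fun h => (inter _ mi h).elim (xne i) yi
  have mj' : x * cs.simple j ∉ C₁ := fun h => (inter _ h mj).elim (xne j) yj
  have hij : cs.simple i ≠ cs.simple j := fun h => mi' (h ▸ mj)
  -- translate to `w = x⁻¹ y`
  have tr : ∀ v, weakLE cs x (x * v) → weakLE cs (x * v) y → weakLE cs v (x⁻¹ * y) := by
    intro v h1 h2
    unfold weakLE at *
    have e : (x * v)⁻¹ * y = v⁻¹ * (x⁻¹ * y) := by group
    rw [e] at h2
    rw [inv_mul_cancel_left] at h1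
    omega
  have tr' : ∀ v, weakLE cs v (x⁻¹ * y) → weakLE cs x (x * v) ∧ weakLE cs (x * v) y := by
    intro v h
    unfold weakLE at *
    have e : (x * v)⁻¹ * y = v⁻¹ * (x⁻¹ * y) := by group
    rw [e, inv_mul_cancel_left]
    have h1 := cs.length_mul_le x v
    have h2 := cs.length_mul_le (x * v) (v⁻¹ * (x⁻¹ * y))
    have e2 : x * v * (v⁻¹ * (x⁻¹ * y)) = y := by group
    rw [e2] at h2
    omega
  have selfN : ∀ k, cs.simple k ∈ N cs (cs.simple k) := fun k => eta_refl cs (cs.isReflection_simple k)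
  have wi := (weakLE_iff cs).1 (tr _ ii.1 ii.2) (selfN i)
  have wj := (weakLE_iff cs).1 (tr _ jj.1 jj.2) (selfN j)
  refine ⟨i, j, hij, ?_, wi, wj⟩
  obtain ⟨u, hu, hN⟩ := exists_parabolic_part cs _ (N_subset_closure cs i j) (x⁻¹ * y)
  have huw : weakLE cs u (x⁻¹ * y) := (weakLE_iff cs).2 (by rw [hN]; exact Set.inter_subset_left)
  have hxu : x * u ∈ IccR (weakLE cs) x y := tr' u huw
  have below : ∀ k, cs.simple k ∈ N cs u → weakLE cs (x * cs.simple k) (x * u) := by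
    intro k hk
    have hk' := ((eta_isLeftInversion cs hk)).2
    have hd : cs.IsLeftDescent u k := hk'
    rw [cs.isLeftDescent_iff] at hd
    have h1 := hxu.1
    unfold weakLE at *
    have e : (x * cs.simple k)⁻¹ * (x * u) = cs.simple k * u := by
      rw [mul_inv_rev, cs.inv_simple]; group
    rw [inv_mul_cancel_left] at h1
    rw [e]
    have h2 := cs.length_mul_le x (cs.simple k)
    rw [cs.length_simple] at h2
    have h3 := cs.length_mul_le (x * cs.simple k) (cs.simple k * u)
    have e2 : x * cs.simple k * (cs.simple k * u) = x * u := by simp [mul_assoc]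
    rw [e2] at h3
    omega
  have ui : cs.simple i ∈ N cs u := by
    rw [hN]; exact ⟨wi, Subgroup.subset_closure (by simp)⟩
  have uj : cs.simple j ∈ N cs u := by
    rw [hN]; exact ⟨wj, Subgroup.subset_closure (by simp)⟩
  have u1 := ((pair_in cs hP ii hxu (below i ui)).resolve_right (fun h => mi' h.1)).2
  have u2 := ((pair_in cs hP jj hxu (below j uj)).resolve_left (fun h => mj' h.1)).2
  rcases inter _ u1 u2 with h | h
  · rw [mul_eq_left] at h
    subst h
    have : eta cs 1 (cs.simple i) = 1 := ui
    simp [eta_one] at this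
  · rw [← h, inv_mul_cancel_left]; exact hu

lemma mem_Icc_iff {x y : W} (hxy : weakLE cs x y) (v : W) :
    x * v ∈ IccR (weakLE cs) x y ↔ N cs v ⊆ N cs (x⁻¹ * y) := by
  rw [← weakLE_iff]
  have e : (x * v)⁻¹ * y = v⁻¹ * (x⁻¹ * y) := by group
  constructor
  · rintro ⟨h1, h2⟩
    unfold weakLE at *
    rw [e] at h2
    rw [inv_mul_cancel_left] at h1
    omega
  · intro h
    change weakLE cs x (x * v) ∧ weakLE cs (x * v) y
    unfold weakLE at *
    rw [e, inv_mul_cancel_left]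
    have h1 := cs.length_mul_le x v
    have h2 := cs.length_mul_le (x * v) (v⁻¹ * (x⁻¹ * y))
    have e2 : x * v * (v⁻¹ * (x⁻¹ * y)) = y := by group
    rw [e2] at h2
    omega

lemma N_simple (i : B) : N cs (cs.simple i) = {cs.simple i} := by
  ext t
  change eta cs _ t = 1 ↔ t = cs.simple i
  rw [eta_simple]
  split_ifs with h <;> simp [h]

lemma N_one : N cs 1 = ∅ := by
  ext t
  change eta cs _ t = 1 ↔ False
  simp [eta_one]

lemma square_iff [Finite W] {x y : W} (hxy : weakLE cs x y) {i j : B}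
    (hij : cs.simple i ≠ cs.simple j)
    (hi : cs.simple i ∈ N cs (x⁻¹ * y)) (hj : cs.simple j ∈ N cs (x⁻¹ * y))
    (hN : N cs (x⁻¹ * y) = reflectionsIn cs (Subgroup.closure {cs.simple i, cs.simple j})) :
    (IccR (weakLE cs) x y).ncard = 4 ↔ N cs (x⁻¹ * y) = {cs.simple i, cs.simple j} ∧
      cs.simple i * cs.simple j = cs.simple j * cs.simple i := by
  set w := x⁻¹ * y with hw
  have si := simple_ne_one cs i
  have sj := simple_ne_one cs j
  have ii := cs.simple_mul_simple_self i
  have jj := cs.simple_mul_simple_self j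
  have card : (IccR (weakLE cs) x y).ncard = {v | N cs v ⊆ N cs w}.ncard := by
    rw [← Set.ncard_image_of_injective {v | N cs v ⊆ N cs w} (mul_right_injective x)]
    congr 1
    ext z
    constructor
    · intro h
      refine ⟨x⁻¹ * z, ?_, by simp⟩
      exact (mem_Icc_iff cs hxy _).1 (by simpa using h)
    · rintro ⟨v, hv, rfl⟩
      exact (mem_Icc_iff cs hxy v).2 hv
  have wi : cs.simple i ≠ w := fun h => by
    rw [← h, N_simple] at hj; exact hij hj.symm
  have wj : cs.simple j ≠ w := fun h => by
    rw [← h, N_simple] at hi; exact hij hi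
  have w1 : 1 ≠ w := fun h => by
    rw [← h, N_one] at hi; exact hi
  have card4 : ({1, cs.simple i, cs.simple j, w} : Set W).ncard = 4 := by
    rw [Set.ncard_insert_of_notMem, Set.ncard_insert_of_notMem, Set.ncard_pair wj]
    · simp [hij, wi]
    · simp [si.symm, sj.symm, w1]
  have sub4 : ({1, cs.simple i, cs.simple j, w} : Set W) ⊆ {v | N cs v ⊆ N cs w} := by
    rintro v (rfl | rfl | rfl | rfl)
    · change N cs 1 ⊆ _; rw [N_one]; exact Set.empty_subset _
    · change N cs _ ⊆ _; rw [N_simple]; simpa using hi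
    · change N cs _ ⊆ _; rw [N_simple]; simpa using hj
    · exact fun t ht => ht
  rw [card]
  constructor
  · intro h
    have heq := Set.eq_of_subset_of_ncard_le sub4 (by rw [h, card4]) (Set.toFinite _)
    have hJ : cs.simple i * cs.simple j ∈ Subgroup.closure {cs.simple i, cs.simple j} :=
      mul_mem (Subgroup.subset_closure (by simp)) (Subgroup.subset_closure (by simp))
    have hab : cs.simple i * cs.simple j ∈ {v | N cs v ⊆ N cs w} := by
      intro t ht
      rw [hN]
      exact ⟨(eta_isLeftInversion cs ht).1, N_subset_closure cs i j _ hJ ht⟩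
    rw [← heq] at hab
    have hab' : cs.simple i * cs.simple j = w := by
      rcases hab with h | h | h | h
      · exact absurd (by rw [eq_inv_of_mul_eq_one_left h, cs.inv_simple]) hij
      · exact absurd (mul_eq_left.mp h) sj
      · exact absurd (mul_eq_right.mp h) si
      · exact h
    have hNw : ∀ t, t ∈ N cs w → t = cs.simple i ∨ t = cs.simple i * cs.simple j * cs.simple i := by
      intro t ht
      rw [← hab'] at ht
      have ht : eta cs _ t = 1 := ht
      rw [eta_mul, eta_simple, eta_simple] at ht
      by_contra hcon
      push Not at hcon
      rw [if_neg hcon.1, if_neg, add_zero] at ht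
      · simp at ht
      · intro h3
        apply hcon.2
        rw [← h3, cs.inv_simple]
        simp only [mul_assoc, ii, mul_one]
        rw [← mul_assoc, ii, one_mul]
    have hj2 := (hNw _ hj).resolve_left hij.symm
    refine ⟨?_, ?_⟩
    · ext t
      constructor
      · intro ht
        rcases hNw t ht with h | h
        · exact Or.inl h
        · right; rw [h]; exact hj2.symm
      · rintro (rfl | rfl)
        · exact hi
        · exact hj
    · nth_rw 2 [hj2]
      rw [mul_assoc _ _ (cs.simple i), ii, mul_one]
  · rintro ⟨h, -⟩
    rw [← card4]
    congr 1
    refine Set.Subset.antisymm (fun v hv => ?_) sub4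
    have hv : N cs v ⊆ N cs w := hv
    rw [h, Set.subset_pair_iff_eq] at hv
    rcases hv with hv | hv | hv | hv
    · left; exact N_inj cs (by rw [hv, N_one])
    · right; left; exact N_inj cs (by rw [hv, N_simple])
    · right; right; left; exact N_inj cs (by rw [hv, N_simple])
    · right; right; right; exact N_inj cs (by rw [hv, h])

end
end PolyAux

/-- Let `(W, S)` be a finite Coxeter system and let `(x, y, C₁, C₂)` be a polygon
in the right weak order on `W`.  Then there is a maximal dihedral reflection
subgroup `D` of `W` such that, for each of the two maximal chains of the
polygon, the set of labels of its covering relations equals the set of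
reflections of `W` contained in `D`.  Moreover, the polygon is a square if and
only if `D` contains exactly two reflections and these commute. -/
theorem polygon_labels_dihedral {B W : Type*} [Group W] {M : CoxeterMatrix B}
    (cs : CoxeterSystem M W) [Finite W]
    (x y : W) (C₁ C₂ : Set W)
    (hP : IsPolygonPair (weakLE cs) x y C₁ C₂) :
    ∃ D : Subgroup W, IsMaxDihedralSubgroup cs D ∧
      chainLabels cs C₁ = reflectionsIn cs D ∧
      chainLabels cs C₂ = reflectionsIn cs D ∧
      ((IccR (weakLE cs) x y).ncard = 4 ↔
        ∃ t₁ t₂ : W, t₁ ≠ t₂ ∧ reflectionsIn cs D = {t₁, t₂} ∧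
          t₁ * t₂ = t₂ * t₁) := by
  obtain ⟨i, j, hij, hw, hi, hj⟩ := PolyAux.polygon_struct cs hP
  have hN := PolyAux.N_longest cs hij hw hi hj
  have hxy := hP.1
  have hint := hP.2.2.2.2.2.1
  have hx1 : x ∈ C₁ ∩ C₂ := by rw [hint]; simp
  have hy1 : y ∈ C₁ ∩ C₂ := by rw [hint]; simp
  have hD : PolyAux.N cs y \ PolyAux.N cs x = reflectionsIn cs
      ((Subgroup.closure {cs.simple i, cs.simple j}).map (MulAut.conj x).toMonoidHom) := by
    ext t
    have h1 := PolyAux.mem_N_inv_mul cs x y (x⁻¹ * t * x)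
    have e : x * (x⁻¹ * t * x) * x⁻¹ = t := by group
    rw [e, hN, Set.sdiff_eq_empty.2 ((PolyAux.weakLE_iff cs).1 hxy)] at h1
    have h2 : cs.IsReflection (x⁻¹ * t * x) ↔ cs.IsReflection t := by
      have := cs.isReflection_conj_iff x⁻¹ t
      rwa [inv_inv] at this
    change _ ↔ cs.IsReflection t ∧ _ ∈ _
    rw [PolyAux.mem_map_conj, ← h2]
    have h3 : (cs.IsReflection (x⁻¹ * t * x) ∧ x⁻¹ * t * x ∈
      Subgroup.closure {cs.simple i, cs.simple j}) ↔ t ∈ PolyAux.N cs y \ PolyAux.N cs x := by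
      refine h1.trans ⟨fun h => h.resolve_left (fun h => h), Or.inr⟩
    exact h3.symm
  refine ⟨_, PolyAux.max_conj cs hij x, ?_, ?_, ?_⟩
  · rw [PolyAux.chainLabels_eq cs hP.2.1 hx1.1 hy1.1, hD]
  · rw [PolyAux.chainLabels_eq cs hP.2.2.1 hx1.2 hy1.2, hD]
  · rw [PolyAux.square_iff cs hxy hij hi hj hN]
    have him : reflectionsIn cs
        ((Subgroup.closure {cs.simple i, cs.simple j}).map (MulAut.conj x).toMonoidHom) =
        (MulAut.conj x) '' PolyAux.N cs (x⁻¹ * y) := by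
      rw [hN]
      ext t
      constructor
      · rintro ⟨h1, z, hz, rfl⟩
        exact ⟨z, ⟨(cs.isReflection_conj_iff x z).1 h1, hz⟩, rfl⟩
      · rintro ⟨z, ⟨h1, h2⟩, rfl⟩
        exact ⟨(cs.isReflection_conj_iff x z).2 h1, z, h2, rfl⟩
    rw [him]
    constructor
    · rintro ⟨h1, h2⟩
      refine ⟨MulAut.conj x (cs.simple i), MulAut.conj x (cs.simple j),
        fun h => hij ((MulAut.conj x).injective h), ?_, ?_⟩
      · rw [h1, Set.image_pair]
      · rw [← map_mul, h2, map_mul]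
    · rintro ⟨t₁, t₂, hne, h1, h2⟩
      have hpi : MulAut.conj x (cs.simple i) ∈ ({t₁, t₂} : Set W) := h1 ▸ ⟨_, hi, rfl⟩
      have hpj : MulAut.conj x (cs.simple j) ∈ ({t₁, t₂} : Set W) := h1 ▸ ⟨_, hj, rfl⟩
      have hne' : MulAut.conj x (cs.simple i) ≠ MulAut.conj x (cs.simple j) :=
        fun h => hij ((MulAut.conj x).injective h)
      have hcomm : MulAut.conj x (cs.simple i) * MulAut.conj x (cs.simple j) =
          MulAut.conj x (cs.simple j) * MulAut.conj x (cs.simple i) := by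
        rcases hpi with a | a <;> rcases hpj with b | b <;> rw [a, b] <;>
          first | exact h2 | exact h2.symm
      have hset : ({t₁, t₂} : Set W) = {MulAut.conj x (cs.simple i), MulAut.conj x (cs.simple j)} := by
        rcases hpi with a | a <;> rcases hpj with b | b
        · exact absurd (a.trans b.symm) hne'
        · rw [a, b]
        · rw [a, b, Set.pair_comm]
        · exact absurd (a.trans b.symm) hne'
      refine ⟨?_, (MulAut.conj x).injective (by rw [map_mul, map_mul, hcomm])⟩
      apply (MulAut.conj x).injective.image_injective
      rw [h1, hset, Set.image_pair]
end
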